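/- arXiv:1102.0534 — 2 statements merged into one kernel-verified Lean document; each statement's English description precedes it below -/
import Mathlib

section
/- Let k = ρn for some ρ ∈ (0,1] with k and n positive integers. Let Q be a random n × k real matrix distributed according to the Haar probability measure on the Stiefel manifold V_k^n (the set of n × k real matrices with orthonormal columns), and let G be an n × k random matrix with independent N(0, 1/n) entries. Then for every nonnegative, positively homogeneous, convex function |·| on the space of n × k real matrices and every weakly increasing convex function Φ : ℝ → ℝ, one has E Φ(|Q|) ≤ E Φ((1 + ρ/2)·|G|). -/
open MeasureTheory ProbabilityTheory Matrix

/-- The space of `n × k` real matrices carries the product measurable structure. -/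
instance matrixMeasurableSpace (n k : ℕ) : MeasurableSpace (Matrix (Fin n) (Fin k) ℝ) :=
  MeasurableSpace.pi

open scoped RealInnerProductSpace

/-- The mean of the chi distribution with `m` degrees of freedom. -/
noncomputable def chiMean (m : ℕ) : ℝ :=
  √2 * Real.Gamma (((m : ℝ) + 1) / 2) / Real.Gamma ((m : ℝ) / 2)

lemma chiMean_pos {m : ℕ} (hm : 0 < m) : 0 < chiMean m := by
  have hm' : (0 : ℝ) < m := by exact_mod_cast hm
  unfold chiMean
  have := Real.Gamma_pos_of_pos (show (0 : ℝ) < (m + 1) / 2 by positivity)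
  have := Real.Gamma_pos_of_pos (show (0 : ℝ) < (m : ℝ) / 2 by positivity)
  positivity

lemma chiMean_mul_chiMean_succ {m : ℕ} (hm : 0 < m) : chiMean m * chiMean (m + 1) = m := by
  have hm' : (0 : ℝ) < m := by exact_mod_cast hm
  have h1 := (Real.Gamma_pos_of_pos (show (0 : ℝ) < (m + 1) / 2 by positivity)).ne'
  have h2 := (Real.Gamma_pos_of_pos (show (0 : ℝ) < (m : ℝ) / 2 by positivity)).ne'
  have h3 : Real.Gamma (((m : ℝ) + 1 + 1) / 2) = m / 2 * Real.Gamma ((m : ℝ) / 2) := by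
    rw [← Real.Gamma_add_one (by positivity)]; ring_nf
  unfold chiMean
  push_cast
  rw [h3]
  field_simp
  simp

lemma chiMean_sq_le {m : ℕ} (hm : 0 < m) : chiMean m ^ 2 ≤ m := by
  have hm' : (0 : ℝ) < m := by exact_mod_cast hm
  have h1 := Real.Gamma_pos_of_pos (show (0 : ℝ) < (m + 1) / 2 by positivity)
  have h2 := Real.Gamma_pos_of_pos (show (0 : ℝ) < (m : ℝ) / 2 by positivity)
  have h := Real.Gamma_mul_add_mul_le_rpow_Gamma_mul_rpow_Gamma
    (show (0 : ℝ) < (m : ℝ) / 2 by positivity) (show (0 : ℝ) < (m : ℝ) / 2 + 1 by positivity)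
    (a := 1 / 2) (b := 1 / 2) (by norm_num) (by norm_num) (by norm_num)
  rw [Real.Gamma_add_one (by positivity), ← Real.sqrt_eq_rpow, ← Real.sqrt_eq_rpow,
    show 1 / 2 * ((m : ℝ) / 2) + 1 / 2 * (m / 2 + 1) = (m + 1) / 2 by ring] at h
  have h' := pow_le_pow_left₀ h1.le h 2
  rw [mul_pow, Real.sq_sqrt h2.le, Real.sq_sqrt (by positivity)] at h'
  unfold chiMean
  rw [div_pow, mul_pow, Real.sq_sqrt (by norm_num), div_le_iff₀ (by positivity)]
  linarith

lemma chiMean_sq_ge {m : ℕ} (hm : 0 < m) : (m : ℝ) ^ 2 / (m + 1) ≤ chiMean m ^ 2 := by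
  have h1 := chiMean_mul_chiMean_succ hm
  have h2 := chiMean_sq_le (Nat.succ_pos m)
  push_cast at h2
  rw [div_le_iff₀ (by positivity)]
  nth_rw 1 [← h1]
  rw [mul_pow]
  exact mul_le_mul_of_nonneg_left h2 (sq_nonneg _)

lemma chiMean_add_two {m : ℕ} (hm : 0 < m) : chiMean (m + 2) * m = chiMean m * (m + 1) := by
  have h1 := chiMean_mul_chiMean_succ hm
  have h2 := chiMean_mul_chiMean_succ (Nat.succ_pos m)
  have h3 := chiMean_pos (Nat.succ_pos m)
  push_cast [Nat.succ_eq_add_one] at h2 h3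
  have : chiMean (m + 1) * (chiMean (m + 2) * m) = chiMean (m + 1) * (chiMean m * (m + 1)) := by
    linear_combination (m : ℝ) * h2 - (m + 1) * h1
  exact mul_left_cancel₀ h3.ne' this

lemma chiMean_ratio_step {m : ℕ} (hm : 0 < m) :
    chiMean (m + 2) ^ 2 / ((m + 2 : ℕ) - 1 / 2 : ℝ) ≤ chiMean m ^ 2 / (m - 1 / 2) := by
  have hm' : (1 : ℝ) ≤ m := by exact_mod_cast hm
  have h : chiMean (m + 2) = chiMean m * (m + 1) / m := by
    rw [eq_div_iff (by positivity), chiMean_add_two hm]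
  push_cast
  rw [h, div_pow, mul_pow, div_div, div_le_div_iff₀ (mul_pos (by positivity) (by linarith))
    (by linarith), mul_assoc]
  refine mul_le_mul_of_nonneg_left ?_ (sq_nonneg _)
  nlinarith

lemma sqrt_le_chiMean {m : ℕ} (hm : 0 < m) : √((m : ℝ) - 1 / 2) ≤ chiMean m := by
  have hm' : (1 : ℝ) ≤ m := by exact_mod_cast hm
  have step : ∀ j : ℕ, chiMean (m + 2 * j) ^ 2 / ((m + 2 * j : ℕ) - 1 / 2 : ℝ)
      ≤ chiMean m ^ 2 / (m - 1 / 2) := by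
    intro j
    induction j with
    | zero => simp
    | succ j ih => exact (chiMean_ratio_step (m := m + 2 * j) (by omega)).trans ih
  have bound : ∀ j : ℕ, 1 - 1 / ((j : ℝ) + 1) ≤ chiMean m ^ 2 / (m - 1 / 2) := by
    intro j
    refine le_trans ?_ (step j)
    have hx := chiMean_sq_ge (show 0 < m + 2 * j by omega)
    have hxj : (j : ℝ) + 1 ≤ (m + 2 * j : ℕ) := by push_cast; linarith [Nat.cast_nonneg (α := ℝ) j]
    generalize ((m + 2 * j : ℕ) : ℝ) = x at *
    have hj : (0 : ℝ) ≤ j := Nat.cast_nonneg j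
    have hx0 : 0 < x := by linarith
    rw [le_div_iff₀ (by linarith)]
    refine le_trans ?_ hx
    have h1 : 1 - 1 / ((j : ℝ) + 1) ≤ 1 - 1 / x := by
      have := one_div_le_one_div_of_le (by positivity) hxj
      linarith
    refine (mul_le_mul_of_nonneg_right h1 (by linarith)).trans ?_
    rw [le_div_iff₀ (by positivity), one_sub_div hx0.ne', div_mul_eq_mul_div, div_mul_eq_mul_div,
      div_le_iff₀ hx0]
    nlinarith
  have hlim : Filter.Tendsto (fun j : ℕ => 1 - 1 / ((j : ℝ) + 1)) Filter.atTop (nhds (1 - 0)) :=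
    tendsto_const_nhds.sub tendsto_one_div_add_atTop_nhds_zero_nat
  have := le_of_tendsto' hlim bound
  rw [sub_zero, le_div_iff₀ (by linarith), one_mul] at this
  exact Real.sqrt_le_iff.mpr ⟨(chiMean_pos hm).le, this⟩

lemma sub_le_sqrt_sub_half {x : ℝ} (hx : 1 ≤ x) :
    2 / 3 * (√x ^ 3 - √(x - 1) ^ 3) ≤ √(x - 1 / 2) := by
  have hp := Real.sq_sqrt (show 0 ≤ x by linarith)
  have hq := Real.sq_sqrt (show 0 ≤ x - 1 by linarith)
  set p := √x
  set q := √(x - 1)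
  have hp0 : 0 ≤ p := Real.sqrt_nonneg _
  have hq0 : 0 ≤ q := Real.sqrt_nonneg _
  apply Real.le_sqrt_of_sq_le
  have h1 : x - 1 / 2 = (p ^ 2 + q ^ 2) / 2 * ((p - q) * (p + q)) ^ 2 := by
    have : (p - q) * (p + q) = 1 := by linear_combination hp - hq
    rw [this]; linear_combination -(hp + hq) / 2
  have h2 : 8 * (p ^ 2 + p * q + q ^ 2) ^ 2 ≤ 9 * ((p ^ 2 + q ^ 2) * (p + q) ^ 2) := by
    nlinarith [sq_nonneg (p - q), mul_nonneg hp0 hq0, sq_nonneg (p ^ 2 - q ^ 2),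
      mul_nonneg (mul_nonneg hp0 hq0) (sq_nonneg (p - q))]
  rw [h1]
  nlinarith [mul_le_mul_of_nonneg_right h2 (sq_nonneg (p - q))]

lemma le_sum_chiMean (n k : ℕ) (hk : k ≤ n) :
    2 / 3 * (√(n : ℝ) ^ 3 - √((n : ℝ) - k) ^ 3) ≤ ∑ i ∈ Finset.range k, chiMean (n - i) := by
  induction k with
  | zero => simp
  | succ k ih =>
    have ih := ih (by omega)
    rw [Finset.sum_range_succ]
    have h1 := sqrt_le_chiMean (show 0 < n - k by omega)
    have hkn : ((k : ℝ) + 1) ≤ n := by exact_mod_cast hk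
    rw [Nat.cast_sub (by omega)] at h1
    have h2 := sub_le_sqrt_sub_half (show (1 : ℝ) ≤ n - k by linarith)
    push_cast
    rw [show (n : ℝ) - (k + 1) = n - k - 1 by ring]
    linarith

lemma inv_le_average_chiMean (n k : ℕ) (hn : 0 < n) (hk : 0 < k) (ρ : ℝ) (hρ0 : 0 < ρ)
    (hρ1 : ρ ≤ 1) (hkn : (k : ℝ) = ρ * n) :
    (1 + ρ / 2)⁻¹ ≤ (∑ i ∈ Finset.range k, chiMean (n - i)) / (k * √(n : ℝ)) := by
  have hn' : (0 : ℝ) < n := by exact_mod_cast hn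
  have hk' : (0 : ℝ) < k := by exact_mod_cast hk
  have hle : k ≤ n := by
    have : (k : ℝ) ≤ n := by rw [hkn]; nlinarith
    exact_mod_cast this
  have h := le_sum_chiMean n k hle
  have hs := Real.sq_sqrt (show 0 ≤ 1 - ρ by linarith)
  have hs0 := Real.sqrt_nonneg (1 - ρ)
  rw [hkn, show (n : ℝ) - ρ * n = n * (1 - ρ) by ring, Real.sqrt_mul hn'.le] at h
  have hr := Real.sq_sqrt hn'.le
  have hr0 : 0 < √(n : ℝ) := Real.sqrt_pos.mpr hn'
  set s := √(1 - ρ)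
  set r := √(n : ℝ)
  have hs1 : s ≤ 1 := by nlinarith
  rw [le_div_iff₀ (by positivity)]
  refine le_trans ?_ h
  rw [hkn, inv_mul_eq_div, div_le_iff₀ (by positivity), ← hr]
  have hρ : ρ = 1 - s ^ 2 := by linarith
  rw [hρ]
  have key : 0 ≤ r ^ 3 * (s ^ 2 * ((1 - s) ^ 2 * (s + 2))) := by positivity
  linarith [show 2 / 3 * (r ^ 3 - (r * s) ^ 3) * (1 + (1 - s ^ 2) / 2) - (1 - s ^ 2) * r ^ 2 * r
    = 1 / 3 * (r ^ 3 * (s ^ 2 * ((1 - s) ^ 2 * (s + 2)))) by ring]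

lemma ofReal_map_integral_le_lintegral {X Ω : Type*} [NormedAddCommGroup X] [NormedSpace ℝ X]
    [FiniteDimensional ℝ X] [MeasurableSpace Ω] {P : Measure Ω} [IsProbabilityMeasure P]
    {H : X → ℝ} (hH : ConvexOn ℝ Set.univ H) (hH0 : ∀ x, 0 ≤ H x) {g : Ω → X}
    (hg : Integrable g P) :
    ENNReal.ofReal (H (∫ ω, g ω ∂P)) ≤ ∫⁻ ω, ENNReal.ofReal (H (g ω)) ∂P := by
  have hcont : Continuous H := continuousOn_univ.mp (hH.continuousOn isOpen_univ)
  by_cases hint : Integrable (fun ω => H (g ω)) P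
  · rw [← ofReal_integral_eq_lintegral_ofReal hint (ae_of_all _ fun ω => hH0 _)]
    exact ENNReal.ofReal_le_ofReal (hH.map_integral_le hcont.continuousOn isClosed_univ
      (by simp) hg hint)
  · have := (lintegral_ofReal_ne_top_iff_integrable
      (hcont.comp_aestronglyMeasurable hg.aestronglyMeasurable)
      (ae_of_all _ fun ω => hH0 _)).not.mpr hint
    rw [not_not] at this
    rw [this]
    exact le_top

lemma exists_isometry_map_eq_add_norm_smul {E : Type*} [NormedAddCommGroup E]
    [InnerProductSpace ℝ E] [FiniteDimensional ℝ E] (K : Submodule ℝ E) {e : E} (he : e ∈ Kᗮ)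
    (he1 : ‖e‖ = 1) (x : E) :
    ∃ U : E ≃ₗᵢ[ℝ] E, (∀ y ∈ K, U y = y) ∧
      U x = K.starProjection x + ‖Kᗮ.starProjection x‖ • e := by
  set w := Kᗮ.starProjection x
  have hw : w ∈ Kᗮ := Kᗮ.starProjection_apply_mem x
  have hnorm : ‖w‖ = ‖‖w‖ • e‖ := by simp [norm_smul, he1]
  let U := (ℝ ∙ (w - ‖w‖ • e))ᗮ.reflection
  have hfix : ∀ y ∈ K, U y = y := by
    intro y hy
    refine Submodule.reflection_mem_subspace_eq_self ?_
    rw [Submodule.mem_orthogonal_singleton_iff_inner_left]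
    exact Submodule.inner_right_of_mem_orthogonal hy (Kᗮ.sub_mem hw (Kᗮ.smul_mem _ he))
  refine ⟨U, hfix, ?_⟩
  conv_lhs => rw [← K.starProjection_add_starProjection_orthogonal x]
  rw [map_add, hfix _ (K.starProjection_apply_mem x)]
  congr 1
  exact Submodule.reflection_sub hnorm

lemma lintegral_pi_fin_succ {X : Type*} [MeasurableSpace X] (γ : Measure X) [SigmaFinite γ]
    (k : ℕ) {f : (Fin (k + 1) → X) → ENNReal} (hf : Measurable f) :
    ∫⁻ g, f g ∂(Measure.pi fun _ => γ) =
      ∫⁻ x, ∫⁻ r, f (Fin.cons x r) ∂(Measure.pi fun _ => γ) ∂γ := by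
  have h := (measurePreserving_piFinSuccAbove (fun _ : Fin (k + 1) => γ) 0).symm
  rw [← h.lintegral_comp hf, lintegral_prod _ (by fun_prop)]
  simp [MeasurableEquiv.piFinSuccAbove, Fin.insertNthEquiv]

section
variable {E : Type*} [NormedAddCommGroup E] [InnerProductSpace ℝ E] [FiniteDimensional ℝ E]
  [MeasurableSpace E] [BorelSpace E]

lemma stdGaussian_eq_withDensity :
    stdGaussian E = (volume : Measure E).withDensity fun x =>
      ENNReal.ofReal ((2 * Real.pi) ^ (-(Module.finrank ℝ E : ℝ) / 2)
        * Real.exp (-(1 / 2) * ‖x‖ ^ 2)) := by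
  have hint : Integrable (fun x : E => (2 * Real.pi) ^ (-(Module.finrank ℝ E : ℝ) / 2)
        * Real.exp (-(1 / 2) * ‖x‖ ^ 2)) := by
    refine Integrable.const_mul ?_ _
    by_contra hcon
    have h0 := integral_undef hcon
    rw [GaussianFourier.integral_rexp_neg_mul_sq_norm (by norm_num)] at h0
    have : 0 < (Real.pi / (1 / 2)) ^ ((Module.finrank ℝ E : ℝ) / 2) := by positivity
    linarith
  have : IsFiniteMeasure ((volume : Measure E).withDensity fun x =>
      ENNReal.ofReal ((2 * Real.pi) ^ (-(Module.finrank ℝ E : ℝ) / 2)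
        * Real.exp (-(1 / 2) * ‖x‖ ^ 2))) :=
    isFiniteMeasure_withDensity_ofReal hint.2
  apply Measure.ext_of_charFun
  ext t
  rw [charFun_stdGaussian, charFun_apply, integral_withDensity_eq_integral_toReal_smul
    (by fun_prop) (by simp)]
  have h := GaussianFourier.integral_cexp_neg_mul_sq_norm_add (V := E) (b := 1 / 2)
    (by norm_num) Complex.I t
  have e1 : ∀ x : E, (ENNReal.ofReal ((2 * Real.pi) ^ (-(Module.finrank ℝ E : ℝ) / 2)
        * Real.exp (-(1 / 2) * ‖x‖ ^ 2))).toReal • Complex.exp (⟪x, t⟫ * Complex.I)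
      = (((2 * Real.pi) ^ (-(Module.finrank ℝ E : ℝ) / 2) : ℝ) : ℂ) *
        Complex.exp (-(1 / 2) * ‖x‖ ^ 2 + Complex.I * ⟪t, x⟫) := by
    intro x
    rw [ENNReal.toReal_ofReal (by positivity), Complex.real_smul, Complex.exp_add,
      real_inner_comm]
    push_cast
    ring_nf
  simp_rw [e1]
  rw [integral_const_mul, h]
  rw [show ((Real.pi : ℂ) / (1 / 2)) = ((2 * Real.pi : ℝ) : ℂ) by push_cast; ring,
    show ((Module.finrank ℝ E : ℂ) / 2) = (((Module.finrank ℝ E : ℝ) / 2 : ℝ) : ℂ) by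
      push_cast; ring, ← Complex.ofReal_cpow (by positivity), ← mul_assoc, ← Complex.ofReal_mul,
    ← Real.rpow_add (by positivity), show -(Module.finrank ℝ E : ℝ) / 2 + Module.finrank ℝ E / 2 = 0
      by ring, Real.rpow_zero]
  rw [Complex.I_sq]
  push_cast
  ring_nf

lemma integral_norm_stdGaussian [Nontrivial E] :
    ∫ x, ‖x‖ ∂(stdGaussian E) = chiMean (Module.finrank ℝ E) := by
  have hm : 0 < Module.finrank ℝ E := Module.finrank_pos
  have key : ∀ f : ℝ → ℝ, ∫ x, f ‖x‖ ∂(stdGaussian E) =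
      (Module.finrank ℝ E • (volume : Measure E).real (Metric.ball 0 1) •
        (2 * Real.pi) ^ (-(Module.finrank ℝ E : ℝ) / 2)) *
      ∫ y in Set.Ioi (0 : ℝ), y ^ (Module.finrank ℝ E - 1) * f y * Real.exp (-(1 / 2) * y ^ 2) := by
    intro f
    rw [stdGaussian_eq_withDensity, integral_withDensity_eq_integral_toReal_smul
      (by fun_prop) (by simp)]
    have := integral_fun_norm_addHaar (volume : Measure E) (fun y =>
      ((2 * Real.pi) ^ (-(Module.finrank ℝ E : ℝ) / 2) * Real.exp (-(1 / 2) * y ^ 2)) * f y)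
    have hpos : ∀ x : E, (ENNReal.ofReal ((2 * Real.pi) ^ (-(Module.finrank ℝ E : ℝ) / 2) *
        Real.exp (-(1 / 2) * ‖x‖ ^ 2))).toReal = (2 * Real.pi) ^ (-(Module.finrank ℝ E : ℝ) / 2) *
        Real.exp (-(1 / 2) * ‖x‖ ^ 2) := fun x => ENNReal.toReal_ofReal (by positivity)
    simp_rw [hpos]
    simp only [smul_eq_mul] at this ⊢
    have hcomm : ∀ y : ℝ, y ^ (Module.finrank ℝ E - 1) *
        ((2 * Real.pi) ^ (-(Module.finrank ℝ E : ℝ) / 2) * Real.exp (-(1 / 2) * y ^ 2) * f y) =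
        (2 * Real.pi) ^ (-(Module.finrank ℝ E : ℝ) / 2) *
          (y ^ (Module.finrank ℝ E - 1) * f y * Real.exp (-(1 / 2) * y ^ 2)) := fun y => by ring
    rw [this]
    simp_rw [hcomm, integral_const_mul, nsmul_eq_mul]
    ring
  have h1 := key (fun _ => 1)
  have h2 := key (fun y => y)
  generalize Module.finrank ℝ E • (volume : Measure E).real (Metric.ball 0 1) •
        (2 * Real.pi) ^ (-(Module.finrank ℝ E : ℝ) / 2) = c at h1 h2
  obtain ⟨m, hm'⟩ : ∃ m, Module.finrank ℝ E = m + 1 := ⟨_, (Nat.succ_pred_eq_of_pos hm).symm⟩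
  have hmom : ∀ q : ℕ, ∫ y in Set.Ioi (0 : ℝ), y ^ q * Real.exp (-(1 / 2) * y ^ 2) =
      (1 / 2) ^ (-((q : ℝ) + 1) / 2) * (1 / 2) * Real.Gamma (((q : ℝ) + 1) / 2) := by
    intro q
    rw [← integral_rpow_mul_exp_neg_mul_rpow (by norm_num)
      (by linarith [Nat.cast_nonneg (α := ℝ) q]) (by norm_num)]
    simp
  rw [h2]
  simp only [hm', Nat.add_sub_cancel, mul_one, ← pow_succ, hmom, integral_const, probReal_univ,
    smul_eq_mul] at h1 ⊢
  have hG1 := (Real.Gamma_pos_of_pos (show (0 : ℝ) < ((m : ℝ) + 1) / 2 by positivity)).ne'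
  have hc : c = ((1 / 2) ^ (-((m : ℝ) + 1) / 2) * (1 / 2) * Real.Gamma (((m : ℝ) + 1) / 2))⁻¹ :=
    eq_inv_of_mul_eq_one_left h1.symm
  have hp : (1 / 2 : ℝ) ^ (-(((m + 1 : ℕ) : ℝ) + 1) / 2) =
      √2 * (1 / 2) ^ (-((m : ℝ) + 1) / 2) := by
    rw [Real.sqrt_eq_rpow, show (2 : ℝ) ^ (1 / 2 : ℝ) = (1 / 2) ^ (-(1 / 2) : ℝ) by
      rw [Real.rpow_neg (by norm_num), ← Real.inv_rpow (by norm_num)]; norm_num,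
      ← Real.rpow_add (by norm_num)]
    push_cast
    ring_nf
  rw [hc, hp, chiMean]
  have : (0 : ℝ) < (1 / 2) ^ (-((m : ℝ) + 1) / 2) := by positivity
  push_cast
  field_simp

lemma map_orthogonalProjection_stdGaussian (K : Submodule ℝ E) :
    (stdGaussian E).map K.orthogonalProjectionOnto = stdGaussian K := by
  apply Measure.ext_of_charFun
  ext t
  rw [charFun_stdGaussian, charFun_apply, integral_map (by fun_prop) (by fun_prop)]
  have h := charFun_stdGaussian (t : E)
  rw [charFun_apply] at h
  simp only [Submodule.coe_norm] at h ⊢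
  rw [← h]
  congr 1 with x
  rw [Submodule.inner_orthogonalProjectionOnto_eq_of_mem_right]

lemma integrable_add_norm_smul (K : Submodule ℝ E) (e : E) :
    Integrable (fun x => K.starProjection x + ‖Kᗮ.starProjection x‖ • e) (stdGaussian E) := by
  have hid : Integrable (fun x : E => x) (stdGaussian E) := IsGaussian.integrable_id
  exact ((K.starProjection).integrable_comp hid).add
    (((Kᗮ.starProjection).integrable_comp hid).norm.smul_const e)

lemma integral_add_norm_smul (K : Submodule ℝ E) (hK : 0 < Module.finrank ℝ Kᗮ) (e : E) :
    ∫ x, K.starProjection x + ‖Kᗮ.starProjection x‖ • e ∂(stdGaussian E) =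
      chiMean (Module.finrank ℝ Kᗮ) • e := by
  have hid : Integrable (fun x : E => x) (stdGaussian E) := IsGaussian.integrable_id
  have : Nontrivial Kᗮ := Module.finrank_pos_iff.mp hK
  rw [integral_add ((K.starProjection).integrable_comp hid)
    (((Kᗮ.starProjection).integrable_comp hid).norm.smul_const e),
    ContinuousLinearMap.integral_comp_comm _ hid, integral_id_stdGaussian, map_zero, zero_add,
    integral_smul_const, ← integral_norm_stdGaussian, ← map_orthogonalProjection_stdGaussian,
    integral_map (by fun_prop) (by fun_prop)]
  rfl

lemma measurePreserving_pi_stdGaussian {ι : Type*} [Fintype ι] (U : E ≃ₗᵢ[ℝ] E) :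
    MeasurePreserving (fun (g : ι → E) i => U (g i)) (Measure.pi fun _ => stdGaussian E)
      (Measure.pi fun _ => stdGaussian E) :=
  measurePreserving_pi _ _ fun _ => ⟨by fun_prop, stdGaussian_map U⟩

/-- Replacing Gaussian columns one at a time by the mean of their Householder normal form
decreases an orthogonally invariant convex functional. -/
lemma ofReal_le_lintegral_of_invariant (k : ℕ) : ∀ (K : Submodule ℝ E) (e : Fin k → E)
    (_ : Orthonormal ℝ e) (_ : ∀ i, e i ∈ Kᗮ) (H : (Fin k → E) → ℝ)
    (_ : ConvexOn ℝ Set.univ H) (_ : ∀ g, 0 ≤ H g)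
    (_ : ∀ U : E ≃ₗᵢ[ℝ] E, (∀ x ∈ K, U x = x) → ∀ g, H (fun i => U (g i)) = H g),
    ENNReal.ofReal (H fun i => chiMean (Module.finrank ℝ Kᗮ - i) • e i) ≤
      ∫⁻ g, ENNReal.ofReal (H g) ∂(Measure.pi fun _ => stdGaussian E) := by
  induction k with
  | zero =>
    intro K e _ _ H _ _ _
    have : ∀ g : Fin 0 → E, H g = H fun i => chiMean (Module.finrank ℝ Kᗮ - i) • e i :=
      fun g => congrArg H (Subsingleton.elim _ _)
    simp_rw [this]
    simp
  | succ k ih =>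
    intro K e he heK H hH hH0 hinv
    have hcont : Continuous H := continuousOn_univ.mp (hH.continuousOn isOpen_univ)
    have hpos : 0 < Module.finrank ℝ Kᗮ := by
      have : Nontrivial Kᗮ := ⟨⟨⟨e 0, heK 0⟩, 0, fun h => he.ne_zero 0 (congrArg Subtype.val h)⟩⟩
      exact Module.finrank_pos
    set T : E → E := fun x => K.starProjection x + ‖Kᗮ.starProjection x‖ • e 0 with hT
    have hcons : Continuous fun p : E × (Fin k → E) => (Fin.cons p.1 p.2 : Fin (k + 1) → E) := by
      fun_prop
    have hconvL (r : Fin k → E) :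
        ConvexOn ℝ Set.univ fun x => H (Fin.cons x r) := by
      refine ⟨convex_univ, fun x _ y _ a b ha hb hab => ?_⟩
      have := hH.2 (Set.mem_univ (Fin.cons x r)) (Set.mem_univ (Fin.cons y r)) ha hb hab
      convert this using 2
      ext i
      refine Fin.cases (by simp) (fun j => ?_) i
      simp [← add_smul, hab]
    have hconvR (x : E) : ConvexOn ℝ Set.univ fun r : Fin k → E => H (Fin.cons x r) := by
      refine ⟨convex_univ, fun r _ s _ a b ha hb hab => ?_⟩
      have := hH.2 (Set.mem_univ (Fin.cons x r)) (Set.mem_univ (Fin.cons x s)) ha hb hab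
      convert this using 2
      ext i
      refine Fin.cases ?_ (fun j => by simp) i
      simp [← add_smul, hab]
    set d := chiMean (Module.finrank ℝ Kᗮ)
    have step : ∫⁻ r, ENNReal.ofReal (H (Fin.cons (d • e 0) r))
          ∂(Measure.pi fun _ => stdGaussian E) ≤
        ∫⁻ g, ENNReal.ofReal (H g) ∂(Measure.pi fun _ => stdGaussian E) := by
      rw [lintegral_pi_fin_succ _ _ (by fun_prop)]
      calc _ ≤ ∫⁻ r, ∫⁻ x, ENNReal.ofReal (H (Fin.cons (T x) r)) ∂(stdGaussian E)
            ∂(Measure.pi fun _ => stdGaussian E) := by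
            refine lintegral_mono fun r => ?_
            rw [← integral_add_norm_smul K hpos (e 0)]
            exact ofReal_map_integral_le_lintegral (hconvL r) (fun _ => hH0 _)
              (integrable_add_norm_smul K (e 0))
        _ = ∫⁻ x, ∫⁻ r, ENNReal.ofReal (H (Fin.cons (T x) r))
              ∂(Measure.pi fun _ => stdGaussian E) ∂(stdGaussian E) := by
            refine lintegral_lintegral_swap ?_
            have : Continuous fun p : (Fin k → E) × E =>
                ENNReal.ofReal (H (Fin.cons (T p.2) p.1)) := by
              refine ENNReal.continuous_ofReal.comp (hcont.comp ?_)
              simp only [hT]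
              fun_prop
            exact this.measurable.aemeasurable
        _ = _ := by
            refine lintegral_congr fun x => ?_
            obtain ⟨U, hU, hUx⟩ := exists_isometry_map_eq_add_norm_smul K (heK 0) (he.1 0) x
            rw [← (measurePreserving_pi_stdGaussian (ι := Fin k) U).lintegral_comp (by fun_prop)]
            refine lintegral_congr fun r => ?_
            rw [← hinv U hU (Fin.cons x r)]
            congr 2
            ext i
            refine Fin.cases ?_ (fun j => ?_) i
            · simp [hUx, hT]
            · simp
    refine le_trans ?_ step
    have horth : ∀ i : Fin k, ⟪e 0, e i.succ⟫ = 0 := fun i => he.2 (Fin.succ_ne_zero i).symm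
    have h0 : e 0 ∉ K := fun h => he.ne_zero 0
      (Submodule.disjoint_def.mp K.orthogonal_disjoint _ h (heK 0))
    have hrank : Module.finrank ℝ (K ⊔ ℝ ∙ e 0 : Submodule ℝ E)ᗮ + 1 = Module.finrank ℝ Kᗮ := by
      have h1 := (K ⊔ ℝ ∙ e 0).finrank_add_finrank_orthogonal
      have h2 := K.finrank_add_finrank_orthogonal
      have h3 := Submodule.finrank_sup_add_finrank_inf_eq K (ℝ ∙ e 0)
      rw [finrank_span_singleton (he.ne_zero 0)] at h3
      have h4 : K ⊓ (ℝ ∙ e 0) = ⊥ :=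
        (Submodule.disjoint_span_singleton' (he.ne_zero 0)).mpr h0 |>.eq_bot
      rw [h4, finrank_bot] at h3
      omega
    have key := ih (K ⊔ ℝ ∙ e 0) (fun i => e i.succ) (he.comp _ (Fin.succ_injective k)) (by
        intro i
        rw [← Submodule.inf_orthogonal]
        exact ⟨heK _, Submodule.mem_orthogonal_singleton_iff_inner_right.mpr (horth i)⟩)
      (fun r => H (Fin.cons (d • e 0) r)) (hconvR _) (fun _ => hH0 _) (by
        intro U hU r
        rw [← hinv U (fun x hx => hU x (Submodule.mem_sup_left hx)) (Fin.cons (d • e 0) r)]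
        congr 1
        ext i
        refine Fin.cases ?_ (fun j => by simp) i
        simp [hU (e 0) (Submodule.mem_sup_right (Submodule.mem_span_singleton_self _))])
    refine le_of_eq_of_le ?_ key
    congr 2
    ext i
    refine Fin.cases (by simp [d]) (fun j => ?_) i
    simp only [Fin.cons_succ, Fin.val_succ]
    congr 2
    omega

end

instance matrixBorelSpace (n k : ℕ) : BorelSpace (Matrix (Fin n) (Fin k) ℝ) :=
  inferInstanceAs (BorelSpace (Fin n → Fin k → ℝ))

lemma continuous_of_convexOn_matrix {n k : ℕ} {F : Matrix (Fin n) (Fin k) ℝ → ℝ}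
    (hF : ConvexOn ℝ Set.univ F) : Continuous F :=
  continuousOn_univ.mp (ConvexOn.continuousOn (E := Fin n → Fin k → ℝ) isOpen_univ hF)

/-- The matrix whose columns are the given vectors, divided by `√n`. -/
noncomputable def scaledColumns {n k : ℕ} (g : Fin k → EuclideanSpace ℝ (Fin n)) :
    Matrix (Fin n) (Fin k) ℝ :=
  Matrix.of fun i j => (√(n : ℝ))⁻¹ * g j i

lemma measurePreserving_transpose_pi {ι κ : Type} {X : Type*} [Fintype ι] [Fintype κ]
    [MeasurableSpace X] (γ : Measure X) [IsProbabilityMeasure γ] :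
    MeasurePreserving (fun (g : κ → ι → X) i j => g j i)
      (Measure.pi fun _ => Measure.pi fun _ => γ) (Measure.pi fun _ => Measure.pi fun _ => γ) := by
  have h (α β : Type) [Fintype α] [Fintype β] :
      MeasurePreserving (MeasurableEquiv.curry α β X) (Measure.pi fun _ => γ)
        (Measure.pi fun _ => Measure.pi fun _ => γ) := by
    refine ⟨(MeasurableEquiv.curry α β X).measurable, ?_⟩
    have := Measure.infinitePi_map_curry (fun (_ : α) (_ : β) => γ)
    simpa only [Measure.infinitePi_eq_pi] using this
  exact ((h ι κ).comp (measurePreserving_piCongrLeft (fun _ : ι × κ => γ)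
    (Equiv.prodComm κ ι))).comp ((h κ ι).symm)

/-- The law of an `n × k` matrix with independent `N(0, 1/n)` entries. -/
noncomputable def gaussianMatrix (n k : ℕ) : Measure (Matrix (Fin n) (Fin k) ℝ) :=
  Measure.pi fun _ => Measure.pi fun _ => gaussianReal 0 ((n : NNReal))⁻¹

instance isProbabilityMeasure_gaussianMatrix (n k : ℕ) :
    IsProbabilityMeasure (gaussianMatrix n k) :=
  inferInstanceAs (IsProbabilityMeasure
    (Measure.pi fun _ : Fin n => Measure.pi fun _ : Fin k => gaussianReal 0 ((n : NNReal))⁻¹))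

lemma measurePreserving_scaledColumns {n k : ℕ} :
    MeasurePreserving (scaledColumns (n := n) (k := k))
      (Measure.pi fun _ => stdGaussian (EuclideanSpace ℝ (Fin n)))
      (gaussianMatrix n k) := by
  have h1 : MeasurePreserving (fun (g : EuclideanSpace ℝ (Fin n)) => WithLp.ofLp g)
      (stdGaussian (EuclideanSpace ℝ (Fin n))) (Measure.pi fun _ => gaussianReal 0 1) := by
    refine ⟨by fun_prop, ?_⟩
    rw [← map_pi_eq_stdGaussian, Measure.map_map (by fun_prop) (by fun_prop)]
    exact Measure.map_id
  have h2 : MeasurePreserving (fun x : ℝ => (√(n : ℝ))⁻¹ * x) (gaussianReal 0 1)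
      (gaussianReal 0 ((n : NNReal))⁻¹) := by
    refine ⟨by fun_prop, ?_⟩
    rw [gaussianReal_map_const_mul]
    congr 1
    · simp
    · ext; simp
  have h3 := measurePreserving_pi (fun _ : Fin k => _) (fun _ : Fin k => _) fun _ => h1
  have h4 := measurePreserving_pi (fun _ : Fin n => _) (fun _ : Fin n => _) fun _ =>
    measurePreserving_pi (fun _ : Fin k => _) (fun _ : Fin k => _) fun _ => h2
  exact (h4.comp (measurePreserving_transpose_pi _)).comp h3

lemma exists_unitary_scaledColumns {n k : ℕ}
    (V : EuclideanSpace ℝ (Fin n) ≃ₗᵢ[ℝ] EuclideanSpace ℝ (Fin n)) :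
    ∃ M : Matrix.unitaryGroup (Fin n) ℝ, ∀ g : Fin k → EuclideanSpace ℝ (Fin n),
      scaledColumns (fun i => V (g i)) = M.1 * scaledColumns g := by
  let u := Unitary.linearIsometryEquiv.symm V
  obtain ⟨M, hM⟩ : ∃ M, toEuclideanCLM (n := Fin n) (𝕜 := ℝ) M = u.1 :=
    EquivLike.surjective (toEuclideanCLM (n := Fin n) (𝕜 := ℝ)) u.1
  refine ⟨⟨M, ?_⟩, fun g => ?_⟩
  · have h1 := Unitary.star_mul_self_of_mem u.2
    rw [Matrix.mem_unitaryGroup_iff']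
    apply EquivLike.injective (toEuclideanCLM (n := Fin n) (𝕜 := ℝ))
    rw [map_mul, map_star, hM, h1, map_one]
  · have h (x : EuclideanSpace ℝ (Fin n)) : V x = toEuclideanCLM (n := Fin n) (𝕜 := ℝ) M x := by
      rw [hM]
      rfl
    ext i j
    simp only [h, scaledColumns, of_apply, mul_apply, ofLp_toEuclideanCLM, mulVec, dotProduct,
      Finset.mul_sum]
    exact Finset.sum_congr rfl fun _ _ => by ring

lemma exists_isometry_scaledColumns {n k : ℕ} (M : Matrix.unitaryGroup (Fin n) ℝ) :
    ∃ V : EuclideanSpace ℝ (Fin n) ≃ₗᵢ[ℝ] EuclideanSpace ℝ (Fin n),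
      ∀ g : Fin k → EuclideanSpace ℝ (Fin n),
        scaledColumns (fun i => V (g i)) = M.1 * scaledColumns g := by
  have hM : toEuclideanCLM (n := Fin n) (𝕜 := ℝ) M.1 ∈
      unitary (EuclideanSpace ℝ (Fin n) →L[ℝ] EuclideanSpace ℝ (Fin n)) := by
    have h1 := Unitary.star_mul_self_of_mem M.2
    have h2 := Unitary.mul_star_self_of_mem M.2
    rw [Unitary.mem_iff, ← map_star, ← map_mul, ← map_mul, h1, h2, map_one]
    exact ⟨rfl, rfl⟩
  have h (x : EuclideanSpace ℝ (Fin n)) : Unitary.linearIsometryEquiv ⟨_, hM⟩ x =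
      toEuclideanCLM (n := Fin n) (𝕜 := ℝ) M.1 x := rfl
  refine ⟨Unitary.linearIsometryEquiv ⟨_, hM⟩, fun g => ?_⟩
  ext i j
  simp only [scaledColumns, of_apply, mul_apply, h,
    ofLp_toEuclideanCLM, mulVec, dotProduct, Finset.mul_sum]
  exact Finset.sum_congr rfl fun _ _ => by ring

instance compactSpace_unitaryGroup (n : ℕ) : CompactSpace (Matrix.unitaryGroup (Fin n) ℝ) := by
  refine isCompact_iff_compactSpace.mp (?_ : IsCompact
    ((Matrix.unitaryGroup (Fin n) ℝ : Submonoid _) : Set (Matrix (Fin n) (Fin n) ℝ)))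
  have hK : IsCompact (Set.pi Set.univ fun _ : Fin n => Set.pi Set.univ fun _ : Fin n =>
      Set.Icc (-1 : ℝ) 1) := isCompact_univ_pi fun _ => isCompact_univ_pi fun _ => isCompact_Icc
  refine IsCompact.of_isClosed_subset (X := Matrix (Fin n) (Fin n) ℝ) hK ?_ ?_
  · have : ((Matrix.unitaryGroup (Fin n) ℝ : Submonoid _) : Set (Matrix (Fin n) (Fin n) ℝ)) =
        {A | star A * A = 1} := by
      ext A
      exact Matrix.mem_unitaryGroup_iff'
    rw [this]
    exact isClosed_eq (by fun_prop) continuous_const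
  · intro A hA i _ j _
    exact abs_le.mp (entry_norm_bound_of_unitary hA i j)

lemma exists_unitaryGroup_leftInvariant (n : ℕ) :
    ∃ m : Measure (Matrix.unitaryGroup (Fin n) ℝ), IsProbabilityMeasure m ∧
      m.IsMulLeftInvariant := by
  refine ⟨Measure.haarMeasure ⊤, ⟨?_⟩, inferInstance⟩
  exact Measure.haarMeasure_self

lemma map_unitary_mul {n k : ℕ} (M : Matrix.unitaryGroup (Fin n) ℝ) :
    (gaussianMatrix n k).map (fun A : Matrix (Fin n) (Fin k) ℝ => M.1 * A) =
      gaussianMatrix n k := by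
  obtain ⟨V, hV⟩ := exists_isometry_scaledColumns (k := k) M
  have h := measurePreserving_scaledColumns (n := n) (k := k)
  have hm : Measurable fun A : Matrix (Fin n) (Fin k) ℝ => M.1 * A :=
    Continuous.measurable (by fun_prop)
  have hV' := measurePreserving_pi (fun _ : Fin k => stdGaussian (EuclideanSpace ℝ (Fin n)))
    (fun _ : Fin k => stdGaussian (EuclideanSpace ℝ (Fin n))) (f := fun _ => V)
    fun _ => ⟨by fun_prop, stdGaussian_map V⟩
  conv_lhs => rw [← h.map_eq]
  rw [Measure.map_map hm h.measurable, ← (h.comp hV').map_eq]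
  congr 1
  ext1 g
  exact (hV g).symm

lemma sum_chiMean_shift (n k : ℕ) [NeZero k] (j : Fin k) :
    ∑ s : Fin k, chiMean (n - (j + s : Fin k)) = ∑ i ∈ Finset.range k, chiMean (n - i) := by
  rw [← Fin.sum_univ_eq_sum_range fun i => chiMean (n - i)]
  exact Fintype.sum_equiv (Equiv.addLeft j) _ _ fun _ => rfl

/-- Gaussian averages of an orthogonally invariant convex functional dominate its value at a
multiple of any matrix with orthonormal columns. -/
lemma ofReal_smul_le_lintegral_of_invariant {n k : ℕ} (hk : 0 < k)
    {G : Matrix (Fin n) (Fin k) ℝ → ℝ} (hG : ConvexOn ℝ Set.univ G) (hG0 : ∀ A, 0 ≤ G A)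
    (hinv : ∀ (M : Matrix.unitaryGroup (Fin n) ℝ) A, G (M.1 * A) = G A)
    {Q : Matrix (Fin n) (Fin k) ℝ} (hQ : Qᵀ * Q = 1) :
    ENNReal.ofReal (G (((∑ i ∈ Finset.range k, chiMean (n - i)) / (k * √(n : ℝ))) • Q)) ≤
      ∫⁻ A, ENNReal.ofReal (G A) ∂(gaussianMatrix n k) := by
  have : NeZero k := ⟨hk.ne'⟩
  have hk' : (0 : ℝ) < k := by exact_mod_cast hk
  have hGm : Measurable G := (continuous_of_convexOn_matrix hG).measurable
  set e : Fin k → EuclideanSpace ℝ (Fin n) := fun j => WithLp.toLp 2 fun i => Q i j with he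
  have horth : Orthonormal ℝ e := by
    rw [orthonormal_iff_ite]
    intro i j
    have := congrFun (congrFun hQ i) j
    simp only [mul_apply, transpose_apply, one_apply] at this
    rw [← this]
    simp [he, PiLp.inner_apply, mul_comm]
  have hshift (s : Fin k) : ENNReal.ofReal
      (G (scaledColumns fun j => chiMean (n - (j + s : Fin k)) • e j)) ≤
        ∫⁻ A, ENNReal.ofReal (G A) ∂(gaussianMatrix n k) := by
    let σ : Fin k ≃ Fin k := Equiv.addRight s
    have hconv : ConvexOn ℝ Set.univ fun g : Fin k → EuclideanSpace ℝ (Fin n) =>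
        G (scaledColumns fun j => g (σ j)) := by
      refine ⟨convex_univ, fun x _ y _ a b ha hb hab => ?_⟩
      refine le_of_eq_of_le (congrArg G ?_) (hG.2 (Set.mem_univ (scaledColumns fun j => x (σ j)))
        (Set.mem_univ (scaledColumns fun j => y (σ j))) ha hb hab)
      ext i j
      simp [scaledColumns]
      ring
    have h := ofReal_le_lintegral_of_invariant k ⊥ (fun i => e (σ.symm i))
      (horth.comp _ σ.symm.injective) (by simp) _ hconv (fun _ => hG0 _) (by
        intro V _ g
        obtain ⟨M, hM⟩ := exists_unitary_scaledColumns (k := k) V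
        simp only [hM fun j => g (σ j), hinv])
    have hperm : MeasurePreserving (fun (g : Fin k → EuclideanSpace ℝ (Fin n)) j => g (σ j))
        (Measure.pi fun _ => stdGaussian _) (Measure.pi fun _ => stdGaussian _) :=
      measurePreserving_arrowCongr' _ _ σ.symm (.refl _) fun _ => .id _
    have hT := (measurePreserving_scaledColumns (n := n) (k := k)).comp hperm
    rw [← hT.lintegral_comp (by fun_prop)]
    have hdim : Module.finrank ℝ (⊥ : Submodule ℝ (EuclideanSpace ℝ (Fin n)))ᗮ = n := by
      rw [Submodule.bot_orthogonal_eq_top, finrank_top, finrank_euclideanSpace_fin]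
    simpa [σ, hdim] using h
  rcases eq_or_ne (∫⁻ A, ENNReal.ofReal (G A) ∂(gaussianMatrix n k)) ⊤ with htop | htop
  · rw [htop]
    exact le_top
  rw [ENNReal.ofReal_le_iff_le_toReal htop]
  simp_rw [ENNReal.ofReal_le_iff_le_toReal htop] at hshift
  have hsum := hG.map_sum_le (t := Finset.univ) (w := fun _ : Fin k => (k : ℝ)⁻¹)
    (p := fun s => scaledColumns fun j => chiMean (n - (j + s : Fin k)) • e j)
    (fun _ _ => by positivity) (by simp [hk'.ne']) (fun _ _ => Set.mem_univ _)
  have havg : ∑ s : Fin k, (k : ℝ)⁻¹ • scaledColumns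
      (fun j => chiMean (n - (j + s : Fin k)) • e j) =
      ((∑ i ∈ Finset.range k, chiMean (n - i)) / (k * √(n : ℝ))) • Q := by
    ext i j
    simp only [Matrix.sum_apply, Matrix.smul_apply, scaledColumns, of_apply, PiLp.smul_apply, he,
      smul_eq_mul, ← sum_chiMean_shift n k j, Finset.sum_div, Finset.sum_mul]
    refine Finset.sum_congr rfl fun s _ => ?_
    rw [div_eq_mul_inv, mul_inv]
    ring
  rw [havg] at hsum
  refine hsum.trans ((Finset.sum_le_sum fun s _ =>
    smul_le_smul_of_nonneg_left (hshift s) (by positivity)).trans_eq ?_)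
  simp [hk'.ne']

lemma unitary_average_mul {n k : ℕ} (m : Measure (Matrix.unitaryGroup (Fin n) ℝ))
    [m.IsMulLeftInvariant] {F : Matrix (Fin n) (Fin k) ℝ → ℝ} (M : Matrix.unitaryGroup (Fin n) ℝ)
    (A : Matrix (Fin n) (Fin k) ℝ) :
    ∫ U : Matrix.unitaryGroup (Fin n) ℝ, F ((U⁻¹).1 * (M.1 * A)) ∂m =
      ∫ U : Matrix.unitaryGroup (Fin n) ℝ, F ((U⁻¹).1 * A) ∂m := by
  rw [← integral_mul_left_eq_self _ M]
  refine integral_congr_ae (ae_of_all _ fun U => congrArg F ?_)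
  change ((M * U)⁻¹).1 * (M.1 * A) = (U⁻¹).1 * A
  rw [_root_.mul_inv_rev, ← Matrix.mul_assoc]
  congr 1
  change ((U⁻¹ * M⁻¹) * M).1 = (U⁻¹).1
  rw [inv_mul_cancel_right]

section Average
variable {n k : ℕ} (m : Measure (Matrix.unitaryGroup (Fin n) ℝ)) [IsProbabilityMeasure m]
  {F : Matrix (Fin n) (Fin k) ℝ → ℝ}

lemma integrable_unitary_orbit (hF : Continuous F) (A : Matrix (Fin n) (Fin k) ℝ) :
    Integrable (fun U : Matrix.unitaryGroup (Fin n) ℝ => F ((U⁻¹).1 * A)) m := by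
  have h : Continuous fun U : Matrix.unitaryGroup (Fin n) ℝ => F ((U⁻¹).1 * A) := by
    have : Continuous fun U : Matrix.unitaryGroup (Fin n) ℝ => (U⁻¹).1 :=
      continuous_subtype_val.comp continuous_inv
    fun_prop
  exact h.integrable_of_hasCompactSupport (HasCompactSupport.of_compactSpace _)

lemma convexOn_unitary_average (hF : ConvexOn ℝ Set.univ F) :
    ConvexOn ℝ Set.univ fun A : Matrix (Fin n) (Fin k) ℝ =>
      ∫ U : Matrix.unitaryGroup (Fin n) ℝ, F ((U⁻¹).1 * A) ∂m := by
  have hint := integrable_unitary_orbit m (continuous_of_convexOn_matrix hF)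
  refine ⟨convex_univ, fun A _ B _ a b ha hb hab => ?_⟩
  simp only [smul_eq_mul]
  rw [← integral_const_mul, ← integral_const_mul,
    ← integral_add ((hint A).const_mul a) ((hint B).const_mul b)]
  refine integral_mono (hint _) (((hint A).const_mul a).add ((hint B).const_mul b)) fun U => ?_
  simp only [Matrix.mul_add, Matrix.mul_smul]
  exact hF.2 (Set.mem_univ _) (Set.mem_univ _) ha hb hab

lemma lintegral_unitary_average (hF : Continuous F) (hF0 : ∀ A, 0 ≤ F A)
    (P : Measure (Matrix (Fin n) (Fin k) ℝ)) [SFinite P]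
    (hP : ∀ M : Matrix.unitaryGroup (Fin n) ℝ, P.map (fun A => M.1 * A) = P) :
    ∫⁻ A, ENNReal.ofReal (∫ U : Matrix.unitaryGroup (Fin n) ℝ, F ((U⁻¹).1 * A) ∂m) ∂P =
      ∫⁻ A, ENNReal.ofReal (F A) ∂P := by
  have hinv : Continuous fun U : Matrix.unitaryGroup (Fin n) ℝ => (U⁻¹).1 :=
    continuous_subtype_val.comp continuous_inv
  calc _ = ∫⁻ A, ∫⁻ U : Matrix.unitaryGroup (Fin n) ℝ, ENNReal.ofReal (F ((U⁻¹).1 * A)) ∂m ∂P :=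
        lintegral_congr fun A => ofReal_integral_eq_lintegral_ofReal
          (integrable_unitary_orbit m hF A) (ae_of_all _ fun _ => hF0 _)
    _ = ∫⁻ U : Matrix.unitaryGroup (Fin n) ℝ, ∫⁻ A, ENNReal.ofReal (F ((U⁻¹).1 * A)) ∂P ∂m := by
        have : SecondCountableTopology (Matrix (Fin n) (Fin k) ℝ) :=
          inferInstanceAs (SecondCountableTopology (Fin n → Fin k → ℝ))
        refine lintegral_lintegral_swap (Continuous.measurable ?_).aemeasurable
        simp only [Function.uncurry_def]
        have : Continuous fun p : Matrix (Fin n) (Fin k) ℝ × Matrix.unitaryGroup (Fin n) ℝ =>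
            (p.2⁻¹).1 * p.1 := (hinv.comp continuous_snd).matrix_mul continuous_fst
        exact ENNReal.continuous_ofReal.comp (hF.comp this)
    _ = ∫⁻ _ : Matrix.unitaryGroup (Fin n) ℝ, ∫⁻ A, ENNReal.ofReal (F A) ∂P ∂m := by
        refine lintegral_congr fun U => ?_
        conv_rhs => rw [← hP U⁻¹]
        rw [lintegral_map (by fun_prop) (Continuous.measurable (by fun_prop))]
    _ = _ := by simp

end Average

/-- The comparison principle for nonnegative convex functions which increase along rays. -/
lemma lintegral_stiefel_le_lintegral_gaussian (n k : ℕ) (hk : 0 < k)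
    (μ : Measure (Matrix (Fin n) (Fin k) ℝ)) [IsProbabilityMeasure μ]
    (hμ_stiefel : ∀ᵐ Q ∂μ, Qᵀ * Q = 1)
    (hμ_inv : ∀ U : Matrix (Fin n) (Fin n) ℝ, Uᵀ * U = 1 → μ.map (fun Q => U * Q) = μ)
    {F : Matrix (Fin n) (Fin k) ℝ → ℝ} (hF : ConvexOn ℝ Set.univ F) (hF0 : ∀ A, 0 ≤ F A)
    (hmono : ∀ (s t : ℝ) (A), 0 ≤ s → s ≤ t → F (s • A) ≤ F (t • A))
    {c : ℝ} (hc0 : 0 ≤ c)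
    (hc : c ≤ (∑ i ∈ Finset.range k, chiMean (n - i)) / (k * √(n : ℝ))) :
    ∫⁻ Q, ENNReal.ofReal (F (c • Q)) ∂μ ≤
      ∫⁻ A, ENNReal.ofReal (F A) ∂(gaussianMatrix n k) := by
  obtain ⟨m, _, _⟩ := exists_unitaryGroup_leftInvariant n
  have hcont := continuous_of_convexOn_matrix hF
  have hcomp : Continuous fun Q : Matrix (Fin n) (Fin k) ℝ => F (c • Q) := by fun_prop
  rw [← lintegral_unitary_average m hcomp (fun _ => hF0 _) μ fun M =>
      hμ_inv M.1 (Matrix.mem_unitaryGroup_iff'.mp M.2),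
    ← lintegral_unitary_average m hcont hF0 _ map_unitary_mul]
  calc _ ≤ ∫⁻ _, ∫⁻ A, ENNReal.ofReal
          (∫ U : Matrix.unitaryGroup (Fin n) ℝ, F ((U⁻¹).1 * A) ∂m)
          ∂(gaussianMatrix n k) ∂μ := by
        refine lintegral_mono_ae ?_
        filter_upwards [hμ_stiefel] with Q hQ
        refine le_trans (ENNReal.ofReal_le_ofReal ?_) (ofReal_smul_le_lintegral_of_invariant hk
          (convexOn_unitary_average m hF) (fun A => integral_nonneg fun _ => hF0 _)
          (unitary_average_mul m) hQ)
        refine integral_mono (integrable_unitary_orbit m hcomp Q)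
          (integrable_unitary_orbit m hcont _) fun U => ?_
        simp only [Matrix.mul_smul]
        exact hmono _ _ _ hc0 hc
    _ = _ := by simp

/-- **Sublinear comparison principle.**  Let `k = ρ n` with `ρ ∈ (0,1]`.  If `μ` is the Haar
probability measure on the Stiefel manifold `V_k^n` (characterized as a probability measure
supported on matrices with orthonormal columns which is invariant under left multiplication
by orthogonal matrices) and `ν` is the law of an `n × k` matrix with independent `N(0, 1/n)`
entries, then for every nonnegative positively homogeneous convex function `N` on matrices
and every weakly increasing convex `Φ : ℝ → ℝ`,
`E Φ(N(Q)) ≤ E Φ((1 + ρ/2) · N(G))`. -/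
theorem sublinear_comparison_principle
    (n k : ℕ) (hn : 0 < n) (hk : 0 < k) (ρ : ℝ) (hρ0 : 0 < ρ) (hρ1 : ρ ≤ 1)
    (hkn : (k : ℝ) = ρ * n)
    (μ : Measure (Matrix (Fin n) (Fin k) ℝ)) [IsProbabilityMeasure μ]
    (hμ_stiefel : ∀ᵐ Q ∂μ, Qᵀ * Q = 1)
    (hμ_inv : ∀ U : Matrix (Fin n) (Fin n) ℝ, Uᵀ * U = 1 →
      μ.map (fun Q => U * Q) = μ)
    (ν : Measure (Matrix (Fin n) (Fin k) ℝ))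
    (hν : ν = Measure.pi fun _ : Fin n => Measure.pi fun _ : Fin k =>
      gaussianReal 0 ((n : NNReal))⁻¹)
    (N : Matrix (Fin n) (Fin k) ℝ → ℝ)
    (hN_nonneg : ∀ M, 0 ≤ N M)
    (hN_hom : ∀ (c : ℝ) (M : Matrix (Fin n) (Fin k) ℝ), 0 ≤ c → N (c • M) = c * N M)
    (hN_convex : ConvexOn ℝ Set.univ N)
    (Φ : ℝ → ℝ) (hΦ_mono : Monotone Φ) (hΦ_convex : ConvexOn ℝ Set.univ Φ)
    (hint : Integrable (fun G => Φ ((1 + ρ / 2) * N G)) ν) :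
    ∫ Q, Φ (N Q) ∂μ ≤ ∫ G, Φ ((1 + ρ / 2) * N G) ∂ν := by
  change ν = gaussianMatrix n k at hν
  subst hν
  have hC : 0 < 1 + ρ / 2 := by linarith
  set F : Matrix (Fin n) (Fin k) ℝ → ℝ := fun A => Φ ((1 + ρ / 2) * N A) - Φ 0 with hFdef
  have hF0 : ∀ A, 0 ≤ F A := fun A =>
    sub_nonneg.mpr (hΦ_mono (mul_nonneg hC.le (hN_nonneg A)))
  have hF : ConvexOn ℝ Set.univ F := by
    refine ⟨convex_univ, fun A _ B _ a b ha hb hab => ?_⟩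
    have h1 := hN_convex.2 (Set.mem_univ A) (Set.mem_univ B) ha hb hab
    have h2 := hΦ_convex.2 (Set.mem_univ ((1 + ρ / 2) * N A))
      (Set.mem_univ ((1 + ρ / 2) * N B)) ha hb hab
    simp only [smul_eq_mul] at h1 h2 ⊢
    have h3 : Φ ((1 + ρ / 2) * N (a • A + b • B)) ≤
        Φ (a * ((1 + ρ / 2) * N A) + b * ((1 + ρ / 2) * N B)) :=
      hΦ_mono (by linarith [mul_le_mul_of_nonneg_left h1 hC.le])
    have h4 : Φ 0 = a * Φ 0 + b * Φ 0 := by rw [← add_mul, hab, one_mul]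
    simp only [hFdef]
    linarith
  have hmono : ∀ (s t : ℝ) (A), 0 ≤ s → s ≤ t → F (s • A) ≤ F (t • A) := by
    intro s t A hs hst
    simp only [hFdef, hN_hom _ A hs, hN_hom _ A (hs.trans hst)]
    gcongr
    · exact hΦ_mono (by gcongr; exact hN_nonneg A)
  have key := lintegral_stiefel_le_lintegral_gaussian n k hk μ hμ_stiefel hμ_inv hF hF0 hmono
    (inv_nonneg.mpr hC.le) (inv_le_average_chiMean n k hn hk ρ hρ0 hρ1 hkn)
  have hscale : ∀ Q, F ((1 + ρ / 2)⁻¹ • Q) = Φ (N Q) - Φ 0 := fun Q => by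
    simp only [hFdef, hN_hom _ Q (inv_nonneg.mpr hC.le), mul_inv_cancel_left₀ hC.ne']
  simp_rw [hscale] at key
  have hFint : Integrable F (gaussianMatrix n k) := hint.sub (integrable_const _)
  rw [← ofReal_integral_eq_lintegral_ofReal hFint (ae_of_all _ hF0)] at key
  have hQ0 : ∀ Q, 0 ≤ Φ (N Q) - Φ 0 := fun Q => sub_nonneg.mpr (hΦ_mono (hN_nonneg Q))
  have hcont : Continuous fun Q => Φ (N Q) - Φ 0 :=
    ((continuousOn_univ.mp (hΦ_convex.continuousOn isOpen_univ)).comp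
      (continuous_of_convexOn_matrix hN_convex)).sub continuous_const
  have hQint : Integrable (fun Q => Φ (N Q) - Φ 0) μ :=
    (lintegral_ofReal_ne_top_iff_integrable hcont.aestronglyMeasurable (ae_of_all _ hQ0)).mp
      (key.trans_lt ENNReal.ofReal_lt_top).ne
  rw [← ofReal_integral_eq_lintegral_ofReal hQint (ae_of_all _ hQ0),
    ENNReal.ofReal_le_ofReal_iff (integral_nonneg hF0)] at key
  have hΦQ : Integrable (fun Q => Φ (N Q)) μ := by
    simpa [Pi.add_def] using hQint.add (g := fun _ => Φ 0) (integrable_const _)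
  rw [integral_sub hΦQ (integrable_const _), integral_sub hint (integrable_const _)] at key
  simpa using key
end

section
/- Let k ≤ n be positive integers. Let Q be a random n × k real matrix distributed according to the Haar probability measure on the Stiefel manifold V_k^n, and let G be an n × k random matrix with independent N(0, 1/n) entries. Then for every nonnegative, positively homogeneous, convex function |·| on the space of n × k real matrices and every weakly increasing convex function Φ : ℝ → ℝ, one has E Φ(|Q|) ≤ E Φ(1.5·|G|). -/
open MeasureTheory ProbabilityTheory Matrix

instance Matrix.borelSpace_real (m n : ℕ) : BorelSpace (Matrix (Fin m) (Fin n) ℝ) :=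
  inferInstanceAs (BorelSpace (Fin m → Fin n → ℝ))

lemma measurable_matrix {α : Type*} [MeasurableSpace α] {m n : ℕ}
    {f : α → Matrix (Fin m) (Fin n) ℝ} (h : ∀ i j, Measurable fun a => f a i j) :
    Measurable f :=
  measurable_pi_lambda _ fun i => measurable_pi_lambda _ fun j => h i j

lemma Measurable.matrix_entry {α : Type*} [MeasurableSpace α] {m n : ℕ}
    {f : α → Matrix (Fin m) (Fin n) ℝ} (h : Measurable f) (i : Fin m) (j : Fin n) :
    Measurable fun a => f a i j :=
  (measurable_pi_apply j).comp ((measurable_pi_apply (X := fun _ : Fin m => Fin n → ℝ) i).comp h)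

lemma Measurable.matrix_mul {α : Type*} [MeasurableSpace α] {l m n : ℕ}
    {f : α → Matrix (Fin l) (Fin m) ℝ} {g : α → Matrix (Fin m) (Fin n) ℝ}
    (hf : Measurable f) (hg : Measurable g) : Measurable fun a => f a * g a := by
  refine measurable_matrix fun i j => ?_
  simp only [Matrix.mul_apply]
  exact Finset.measurable_sum _ fun k _ => (hf.matrix_entry i k).mul (hg.matrix_entry k j)

lemma Measurable.matrix_transpose {α : Type*} [MeasurableSpace α] {m n : ℕ}
    {f : α → Matrix (Fin m) (Fin n) ℝ} (hf : Measurable f) : Measurable fun a => (f a)ᵀ :=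
  measurable_matrix fun i j => hf.matrix_entry j i

/-- The law of a vector of `n` independent `N(0, v)` variables. -/
noncomputable def gaussianVec (n : ℕ) (v : NNReal) : Measure (Fin n → ℝ) :=
  Measure.pi fun _ => gaussianReal 0 v

/-- The law of an `m × n` matrix with independent `N(0, v)` entries. -/
noncomputable def gaussianMat (m n : ℕ) (v : NNReal) : Measure (Matrix (Fin m) (Fin n) ℝ) :=
  Measure.pi fun _ : Fin m => gaussianVec n v

instance (n : ℕ) (v : NNReal) : IsProbabilityMeasure (gaussianVec n v) := by
  unfold gaussianVec; infer_instance

instance (m n : ℕ) (v : NNReal) : IsProbabilityMeasure (gaussianMat m n v) :=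
  inferInstanceAs (IsProbabilityMeasure (Measure.pi fun _ : Fin m => gaussianVec n v))

lemma dotProduct_mulVec_self_of_transpose_mul_self {n k : ℕ} {Q : Matrix (Fin n) (Fin k) ℝ}
    (hQ : Qᵀ * Q = 1) (t : Fin k → ℝ) : (Q *ᵥ t) ⬝ᵥ (Q *ᵥ t) = t ⬝ᵥ t := by
  rw [Matrix.dotProduct_mulVec, ← Matrix.mulVec_transpose, Matrix.mulVec_mulVec, hQ,
    Matrix.one_mulVec]

lemma gaussianVec_map_vecMul {n k : ℕ} (v : NNReal) {Q : Matrix (Fin n) (Fin k) ℝ}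
    (hQ : Qᵀ * Q = 1) : (gaussianVec n v).map (fun h => h ᵥ* Q) = gaussianVec k v := by
  have hm : Measurable fun h : Fin n → ℝ => h ᵥ* Q := by
    refine measurable_pi_lambda _ fun j => ?_
    simp only [Matrix.vecMul, dotProduct]
    fun_prop
  have : IsProbabilityMeasure ((gaussianVec n v).map (fun h => h ᵥ* Q)) :=
    Measure.isProbabilityMeasure_map hm.aemeasurable
  refine charFun_eq_pi_iff.mp fun t => ?_
  have key : charFun (((gaussianVec n v).map (fun h => h ᵥ* Q)).map (WithLp.toLp 2)) t
      = charFun ((gaussianVec n v).map (WithLp.toLp 2)) (WithLp.toLp 2 (Q *ᵥ t.ofLp)) := by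
    simp_rw [charFun, ← MeasurableEquiv.coe_toLp, integral_map_equiv]
    rw [integral_map hm.aemeasurable]
    · refine integral_congr_ae (ae_of_all _ fun h => ?_)
      simp only [MeasurableEquiv.coe_toLp, PiLp.inner_apply]
      have : (∑ i, inner ℝ ((h ᵥ* Q) i) (t.ofLp i)) = ∑ i, inner ℝ (h i) ((Q *ᵥ t.ofLp) i) := by
        have := Matrix.dotProduct_mulVec h Q t.ofLp
        simp only [dotProduct] at this
        simp [mul_comm] at this ⊢
        rw [← this]
      rw [this]
    · exact Measurable.aestronglyMeasurable (by fun_prop)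
  rw [key, gaussianVec, charFun_pi]
  simp_rw [charFun_gaussianReal, ← Complex.exp_sum]
  congr 1
  have := dotProduct_mulVec_self_of_transpose_mul_self hQ t.ofLp
  simp only [dotProduct, ← pow_two] at this
  simp only [Complex.ofReal_zero, mul_zero, zero_mul, zero_sub, Finset.sum_neg_distrib,
    ← Finset.sum_div, ← Finset.mul_sum]
  norm_cast
  rw [this]

lemma gaussianMat_map_mul {m n k : ℕ} (v : NNReal) {Q : Matrix (Fin n) (Fin k) ℝ}
    (hQ : Qᵀ * Q = 1) : (gaussianMat m n v).map (fun H => H * Q) = gaussianMat m k v := by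
  have hm : Measurable fun h : Fin n → ℝ => h ᵥ* Q := by
    refine measurable_pi_lambda _ fun j => ?_
    simp only [Matrix.vecMul, dotProduct]
    fun_prop
  have : ∀ _ : Fin m, IsProbabilityMeasure ((gaussianVec n v).map (fun h => h ᵥ* Q)) := fun _ =>
    Measure.isProbabilityMeasure_map hm.aemeasurable
  have h := Measure.pi_map_pi (μ := fun _ : Fin m => gaussianVec n v)
    (f := fun _ h => h ᵥ* Q) (fun _ => hm.aemeasurable)
  simp only [gaussianVec_map_vecMul v hQ] at h
  exact h

/-- The signed permutation matrix with `ε i` in position `(i, σ i)`. -/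
def signedPerm {n : ℕ} (σ : Equiv.Perm (Fin n)) (ε : Fin n → ℤˣ) : Matrix (Fin n) (Fin n) ℝ :=
  Matrix.of fun i j => if σ i = j then ((ε i : ℤ) : ℝ) else 0

lemma intUnits_cast_mul_self (e : ℤˣ) : ((e : ℤ) : ℝ) * ((e : ℤ) : ℝ) = 1 := by
  norm_cast
  simp

lemma signedPerm_mul {n k : ℕ} (σ : Equiv.Perm (Fin n)) (ε : Fin n → ℤˣ)
    (M : Matrix (Fin n) (Fin k) ℝ) (i : Fin n) (j : Fin k) :
    (signedPerm σ ε * M) i j = ((ε i : ℤ) : ℝ) * M (σ i) j := by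
  simp [signedPerm, Matrix.mul_apply]

lemma mul_signedPerm_transpose {n k : ℕ} (σ : Equiv.Perm (Fin n)) (ε : Fin n → ℤˣ)
    (M : Matrix (Fin k) (Fin n) ℝ) (i : Fin k) (j : Fin n) :
    (M * (signedPerm σ ε)ᵀ) i j = ((ε j : ℤ) : ℝ) * M i (σ j) := by
  simp [signedPerm, Matrix.mul_apply, mul_comm]

lemma signedPerm_mul_transpose {n : ℕ} (σ : Equiv.Perm (Fin n)) (ε : Fin n → ℤˣ) :
    signedPerm σ ε * (signedPerm σ ε)ᵀ = 1 := by
  ext i j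
  rw [signedPerm_mul]
  simp only [signedPerm, Matrix.transpose_apply, Matrix.of_apply, Matrix.one_apply,
    EmbeddingLike.apply_eq_iff_eq]
  by_cases h : i = j
  · subst h; simp [intUnits_cast_mul_self]
  · simp [h, Ne.symm h]

lemma gaussianMat_map_signedPerm_mul {n k : ℕ} (v : NNReal) (σ : Equiv.Perm (Fin n))
    (ε : Fin n → ℤˣ) :
    (gaussianMat n k v).map (fun H => signedPerm σ ε * H) = gaussianMat n k v := by
  have hsmul : ∀ i, (gaussianVec k v).map (fun h => ((ε i : ℤ) : ℝ) • h) = gaussianVec k v := by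
    intro i
    have hQ : (((ε i : ℤ) : ℝ) • (1 : Matrix (Fin k) (Fin k) ℝ))ᵀ * (((ε i : ℤ) : ℝ) • 1) = 1 := by
      simp [smul_smul, intUnits_cast_mul_self]
    simpa only [Matrix.vecMul_smul, Matrix.vecMul_one] using gaussianVec_map_vecMul v hQ
  have : ∀ i, IsProbabilityMeasure
      ((gaussianVec k v).map (fun h : Fin k → ℝ => ((ε i : ℤ) : ℝ) • h)) := fun i => by
    rw [hsmul]; infer_instance
  have h1 := Measure.pi_map_pi (μ := fun _ : Fin n => gaussianVec k v)
    (f := fun i h => ((ε i : ℤ) : ℝ) • h) (fun _ => Measurable.aemeasurable (by fun_prop))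
  simp only [hsmul] at h1
  have h2 := measurePreserving_piCongrLeft (α := fun _ : Fin n => Fin k → ℝ)
    (fun _ : Fin n => gaussianVec k v) σ.symm
  have h3 : MeasurePreserving (fun (x : Fin n → Fin k → ℝ) i => ((ε i : ℤ) : ℝ) • x i)
      (Measure.pi fun _ : Fin n => gaussianVec k v) (Measure.pi fun _ : Fin n => gaussianVec k v) :=
    ⟨by fun_prop, h1⟩
  have h4 := (h3.comp h2).map_eq
  refine Eq.trans ?_ h4
  refine congrArg (fun g => Measure.map g (gaussianMat n k v)) ?_
  ext H i j
  rw [signedPerm_mul]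
  have : (Equiv.piCongrLeft (fun _ : Fin n => Fin k → ℝ) σ.symm) H i = H (σ i) := by
    have := Equiv.piCongrLeft_apply_apply (fun _ : Fin n => Fin k → ℝ) σ.symm H (σ i)
    simpa using this
  simp only [Function.comp, MeasurableEquiv.coe_piCongrLeft, this]
  rfl

lemma abs_entry_le_one_of_transpose_mul_self {n k : ℕ} {Q : Matrix (Fin n) (Fin k) ℝ}
    (hQ : Qᵀ * Q = 1) (i : Fin n) (j : Fin k) : |Q i j| ≤ 1 := by
  have h := congrFun (congrFun hQ j) j
  simp only [Matrix.mul_apply, Matrix.transpose_apply, Matrix.one_apply_eq, ← pow_two] at h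
  rw [← sq_le_one_iff_abs_le_one, ← h]
  exact Finset.single_le_sum (f := fun i => Q i j ^ 2) (fun _ _ => sq_nonneg _) (Finset.mem_univ i)

lemma integrable_gaussianMat_entry {m n : ℕ} (v : NNReal) (i : Fin m) (j : Fin n) :
    Integrable (fun H : Matrix (Fin m) (Fin n) ℝ => H i j) (gaussianMat m n v) := by
  have h1 : Integrable (fun x : ℝ => x) (gaussianReal 0 v) :=
    memLp_one_iff_integrable.1 (memLp_id_gaussianReal' 1 (by simp))
  have h2 : Integrable (fun x : Fin n → ℝ => x j) (gaussianVec n v) :=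
    (measurePreserving_eval (fun _ : Fin n => gaussianReal 0 v) j).integrable_comp_of_integrable h1
  exact (measurePreserving_eval (fun _ : Fin m => gaussianVec n v) i).integrable_comp_of_integrable
    h2

lemma integrable_gaussianMat_mul_transpose_entry {n : ℕ} (v : NNReal)
    {U : Matrix (Fin n) (Fin n) ℝ → Matrix (Fin n) (Fin n) ℝ} (hU : Measurable U)
    (hUo : ∀ H, U H * (U H)ᵀ = 1) (i j : Fin n) :
    Integrable (fun H => (H * (U H)ᵀ) i j) (gaussianMat n n v) := by
  simp only [Matrix.mul_apply, Matrix.transpose_apply]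
  refine integrable_finsetSum _ fun l _ => ?_
  refine (integrable_gaussianMat_entry v i l).mul_bdd (c := 1)
    (hU.matrix_entry j l).aestronglyMeasurable (ae_of_all _ fun H => ?_)
  have := abs_entry_le_one_of_transpose_mul_self (Q := (U H)ᵀ)
    (by rw [Matrix.transpose_transpose]; exact hUo H) l j
  simpa using this

lemma integrable_of_bounded_on_stiefel {n k : ℕ} {μ : Measure (Matrix (Fin n) (Fin k) ℝ)}
    [IsProbabilityMeasure μ] (hμ : ∀ᵐ Q ∂μ, Qᵀ * Q = 1) {g : Matrix (Fin n) (Fin k) ℝ → ℝ}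
    (hg : Continuous g) : Integrable g μ := by
  have hK : IsCompact (Set.univ.pi fun _ : Fin n => Set.univ.pi fun _ : Fin k =>
      Set.Icc (-1 : ℝ) 1) :=
    isCompact_univ_pi fun _ => isCompact_univ_pi fun _ => isCompact_Icc
  obtain ⟨C, hC⟩ := hK.exists_bound_of_continuousOn (f := g) hg.continuousOn
  refine Integrable.of_bound hg.measurable.aestronglyMeasurable C ?_
  filter_upwards [hμ] with Q hQ
  exact hC Q fun i _ j _ => abs_le.1 (abs_entry_le_one_of_transpose_mul_self hQ i j)

lemma integral_mul_integral_le {n k : ℕ} {μ : Measure (Matrix (Fin n) (Fin k) ℝ)}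
    [IsProbabilityMeasure μ] (hμ : ∀ᵐ Q ∂μ, Qᵀ * Q = 1)
    (hμ_inv : ∀ U : Matrix (Fin n) (Fin n) ℝ, Uᵀ * U = 1 → μ.map (fun Q => U * Q) = μ)
    {v : NNReal} {f : Matrix (Fin n) (Fin k) ℝ → ℝ} (hf : ConvexOn ℝ Set.univ f)
    (hfc : Continuous f) (hint : Integrable f (gaussianMat n k v))
    {U : Matrix (Fin n) (Fin n) ℝ → Matrix (Fin n) (Fin n) ℝ} (hU : Measurable U)
    (hUo : ∀ H, U H * (U H)ᵀ = 1) :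
    ∫ Q, f (Matrix.of (fun i j => ∫ H, (H * (U H)ᵀ) i j ∂gaussianMat n n v) * Q) ∂μ
      ≤ ∫ G, f G ∂gaussianMat n k v := by
  set η := gaussianMat n n v
  have hmp : ∀ Q : Matrix (Fin n) (Fin k) ℝ, Qᵀ * Q = 1 →
      MeasurePreserving (fun H => H * Q) η (gaussianMat n k v) := fun Q hQ =>
    ⟨measurable_id.matrix_mul measurable_const, gaussianMat_map_mul v hQ⟩
  have hFm : Measurable fun p : Matrix (Fin n) (Fin n) ℝ × Matrix (Fin n) (Fin k) ℝ =>
      f (p.1 * p.2) := hfc.measurable.comp (measurable_fst.matrix_mul measurable_snd)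
  have hF : Integrable (fun p : Matrix (Fin n) (Fin n) ℝ × Matrix (Fin n) (Fin k) ℝ =>
      f (p.1 * p.2)) (η.prod μ) := by
    rw [integrable_prod_iff' hFm.aestronglyMeasurable]
    constructor
    · filter_upwards [hμ] with Q hQ
      exact (hmp Q hQ).integrable_comp_of_integrable hint
    · refine (integrable_const (∫ G, ‖f G‖ ∂gaussianMat n k v)).congr ?_
      filter_upwards [hμ] with Q hQ
      rw [← (hmp Q hQ).map_eq, integral_map (hmp Q hQ).measurable.aemeasurable
        hfc.norm.measurable.aestronglyMeasurable]
  have hFint : ∫ p : Matrix (Fin n) (Fin n) ℝ × Matrix (Fin n) (Fin k) ℝ, f (p.1 * p.2) ∂(η.prod μ)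
      = ∫ G, f G ∂gaussianMat n k v := by
    rw [integral_prod_symm _ hF]
    calc _ = ∫ _, (∫ G, f G ∂gaussianMat n k v) ∂μ := by
          refine integral_congr_ae ?_
          filter_upwards [hμ] with Q hQ
          rw [← (hmp Q hQ).map_eq, integral_map (hmp Q hQ).measurable.aemeasurable
            hfc.measurable.aestronglyMeasurable]
      _ = _ := by simp
  have hΨ : MeasurePreserving (fun p : Matrix (Fin n) (Fin n) ℝ × Matrix (Fin n) (Fin k) ℝ =>
      (p.1, (U p.1)ᵀ * p.2)) (η.prod μ) (η.prod μ) := by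
    refine (MeasurePreserving.id η).skew_product (g := fun H Q => (U H)ᵀ * Q)
      ((hU.comp measurable_fst).matrix_transpose.matrix_mul measurable_snd)
      (ae_of_all _ fun H => ?_)
    exact hμ_inv _ (by rw [Matrix.transpose_transpose]; exact hUo H)
  have hG : Integrable (fun p : Matrix (Fin n) (Fin n) ℝ × Matrix (Fin n) (Fin k) ℝ =>
      f (p.1 * (U p.1)ᵀ * p.2)) (η.prod μ) := by
    have := hΨ.integrable_comp_of_integrable hF
    simpa only [Function.comp_def, Matrix.mul_assoc] using this
  have hGint : ∫ p : Matrix (Fin n) (Fin n) ℝ × Matrix (Fin n) (Fin k) ℝ,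
      f (p.1 * (U p.1)ᵀ * p.2) ∂(η.prod μ) = ∫ G, f G ∂gaussianMat n k v := by
    rw [← hFint]
    conv_rhs => rw [← hΨ.map_eq, integral_map hΨ.measurable.aemeasurable
      hFm.aestronglyMeasurable]
    simp only [Matrix.mul_assoc]
  rw [← hGint, integral_prod_symm _ hG]
  have hT : Integrable (fun H => (fun i j => (H * (U H)ᵀ) i j : Fin n → Fin n → ℝ)) η :=
    Integrable.of_eval fun i => Integrable.of_eval fun j =>
      integrable_gaussianMat_mul_transpose_entry v hU hUo i j
  have hTint : ∫ H, (fun i j => (H * (U H)ᵀ) i j : Fin n → Fin n → ℝ) ∂η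
      = fun i j => ∫ H, (H * (U H)ᵀ) i j ∂η := by
    ext i j
    rw [eval_integral fun i => hT.eval i, eval_integral fun j => (hT.eval i).eval j]
  refine integral_mono_ae (integrable_of_bounded_on_stiefel hμ
    (hfc.comp (continuous_const.matrix_mul continuous_id))) hG.integral_prod_right ?_
  filter_upwards [hG.prod_left_ae] with Q hQ
  have hconv : ConvexOn ℝ Set.univ fun M : Fin n → Fin n → ℝ => f (Matrix.of M * Q) := by
    refine ⟨convex_univ, fun x _ y _ a b ha hb hab => ?_⟩
    have : Matrix.of (a • x + b • y) * Q = a • (Matrix.of x * Q) + b • (Matrix.of y * Q) := by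
      rw [← Matrix.smul_mul, ← Matrix.smul_mul, ← Matrix.add_mul]; rfl
    beta_reduce
    rw [this]
    exact hf.2 trivial trivial ha hb hab
  have hcont : Continuous fun M : Fin n → Fin n → ℝ => f (Matrix.of M * Q) :=
    hfc.comp ((continuous_id (X := Matrix (Fin n) (Fin n) ℝ)).matrix_mul continuous_const)
  rw [← hTint]
  exact hconv.map_integral_le hcont.continuousOn isClosed_univ (ae_of_all _ fun _ => trivial) hT hQ

lemma sum_intUnits_mul_eq_zero {n : ℕ} {i j : Fin n} (hij : i ≠ j) :
    ∑ ε : Fin n → ℤˣ, ((ε i : ℤ) : ℝ) * ((ε j : ℤ) : ℝ) = 0 := by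
  have h := Equiv.sum_comp (Equiv.mulLeft (Function.update (1 : Fin n → ℤˣ) i (-1)))
    (fun ε : Fin n → ℤˣ => ((ε i : ℤ) : ℝ) * ((ε j : ℤ) : ℝ))
  simp only [Equiv.coe_mulLeft, Pi.mul_apply, Function.update_self,
    Function.update_of_ne hij.symm, Pi.one_apply, one_mul, neg_mul, Units.val_neg, Int.cast_neg,
    Finset.sum_neg_distrib] at h
  linarith

lemma sum_signedPerm_conj {n : ℕ} [NeZero n] (M : Matrix (Fin n) (Fin n) ℝ) :
    ∑ p : Fin n × (Fin n → ℤˣ), ((n : ℝ) * 2 ^ n)⁻¹ •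
      (Matrix.of fun i j => ((p.2 i : ℤ) : ℝ) * ((p.2 j : ℤ) : ℝ) * M (i + p.1) (j + p.1))
      = (M.trace / n) • (1 : Matrix (Fin n) (Fin n) ℝ) := by
  have hn : (n : ℝ) ≠ 0 := Nat.cast_ne_zero.2 (NeZero.ne n)
  ext i j
  simp only [Matrix.sum_apply, Matrix.smul_apply, Matrix.of_apply, smul_eq_mul, ← Finset.mul_sum,
    Fintype.sum_prod_type, ← Finset.sum_mul]
  by_cases hij : i = j
  · subst hij
    have htr : ∑ x, M (i + x) (i + x) = M.trace :=
      Equiv.sum_comp (Equiv.addLeft i) fun x => M x x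
    simp only [intUnits_cast_mul_self, Finset.sum_const, Finset.card_univ, Fintype.card_pi,
      Fintype.card_units_int, Finset.prod_const, Fintype.card_fin, nsmul_eq_mul, mul_one,
      htr, Matrix.one_apply_eq]
    push_cast
    field_simp
  · simp [sum_intUnits_mul_eq_zero hij, hij]

lemma integral_trace_smul_le {n k : ℕ} [NeZero n] {μ : Measure (Matrix (Fin n) (Fin k) ℝ)}
    [IsProbabilityMeasure μ] (hμ : ∀ᵐ Q ∂μ, Qᵀ * Q = 1)
    (hμ_inv : ∀ U : Matrix (Fin n) (Fin n) ℝ, Uᵀ * U = 1 → μ.map (fun Q => U * Q) = μ)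
    {v : NNReal} {f : Matrix (Fin n) (Fin k) ℝ → ℝ} (hf : ConvexOn ℝ Set.univ f)
    (hfc : Continuous f) (hint : Integrable f (gaussianMat n k v))
    {U : Matrix (Fin n) (Fin n) ℝ → Matrix (Fin n) (Fin n) ℝ} (hU : Measurable U)
    (hUo : ∀ H, U H * (U H)ᵀ = 1) :
    ∫ Q, f (((∫ H, (H * (U H)ᵀ).trace ∂gaussianMat n n v) / n) • Q) ∂μ
      ≤ ∫ G, f G ∂gaussianMat n k v := by
  set I := ∫ G, f G ∂gaussianMat n k v
  have hn : (n : ℝ) ≠ 0 := Nat.cast_ne_zero.2 (NeZero.ne n)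
  let S : Set (Matrix (Fin n) (Fin n) ℝ) := {M | ∫ Q, f (M * Q) ∂μ ≤ I}
  have hfi : ∀ M : Matrix (Fin n) (Fin n) ℝ, Integrable (fun Q => f (M * Q)) μ := fun M =>
    integrable_of_bounded_on_stiefel hμ (hfc.comp (continuous_const.matrix_mul continuous_id))
  have hS : Convex ℝ S := by
    intro x hx y hy a b ha hb hab
    calc ∫ Q, f ((a • x + b • y) * Q) ∂μ
        ≤ ∫ Q, (a * f (x * Q) + b * f (y * Q)) ∂μ := by
          refine integral_mono (hfi _) (((hfi x).const_mul a).add ((hfi y).const_mul b)) fun Q => ?_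
          simp only [Matrix.add_mul, Matrix.smul_mul]
          exact hf.2 trivial trivial ha hb hab
      _ = a * ∫ Q, f (x * Q) ∂μ + b * ∫ Q, f (y * Q) ∂μ := by
          rw [integral_add ((hfi x).const_mul a) ((hfi y).const_mul b), integral_const_mul,
            integral_const_mul]
      _ ≤ a * I + b * I := by gcongr <;> assumption
      _ = I := by rw [← add_mul, hab, one_mul]
  set M : Matrix (Fin n) (Fin n) ℝ :=
    Matrix.of fun i j => ∫ H, (H * (U H)ᵀ) i j ∂gaussianMat n n v with hM
  have htr : ∫ H, (H * (U H)ᵀ).trace ∂gaussianMat n n v = M.trace := by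
    simp only [Matrix.trace, Matrix.diag_apply]
    rw [integral_finsetSum _ fun i _ => integrable_gaussianMat_mul_transpose_entry v hU hUo i i]
    rfl
  have hmem : ∀ p : Fin n × (Fin n → ℤˣ), (Matrix.of fun i j =>
      ((p.2 i : ℤ) : ℝ) * ((p.2 j : ℤ) : ℝ) * M (i + p.1) (j + p.1)) ∈ S := by
    rintro ⟨a, ε⟩
    set V := signedPerm (Equiv.addRight a) ε with hV
    have hVV : V * Vᵀ = 1 := signedPerm_mul_transpose _ _
    have hVV' : Vᵀ * V = 1 := mul_eq_one_comm.1 hVV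
    have hmV : Measurable fun H : Matrix (Fin n) (Fin n) ℝ => V * H :=
      measurable_const.matrix_mul measurable_id
    have hmV' : Measurable fun H : Matrix (Fin n) (Fin n) ℝ => Vᵀ * H :=
      measurable_const.matrix_mul measurable_id
    have hU' : Measurable fun H => V * U (Vᵀ * H) := hmV.comp (hU.comp hmV')
    have h := integral_mul_integral_le hμ hμ_inv hf hfc hint hU' fun H => by
      rw [Matrix.transpose_mul, Matrix.mul_assoc, ← Matrix.mul_assoc (U _), hUo,
        Matrix.one_mul, hVV]
    have hentry : ∀ i j, ∫ H, (H * (V * U (Vᵀ * H))ᵀ) i j ∂gaussianMat n n v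
        = ((ε i : ℤ) : ℝ) * ((ε j : ℤ) : ℝ) * M (i + a) (j + a) := by
      intro i j
      have hm : Measurable fun H : Matrix (Fin n) (Fin n) ℝ => (H * (V * U (Vᵀ * H))ᵀ) i j :=
        (measurable_id.matrix_mul hU'.matrix_transpose).matrix_entry i j
      conv_lhs => rw [← gaussianMat_map_signedPerm_mul v (Equiv.addRight a) ε,
        integral_map hmV.aemeasurable hm.aestronglyMeasurable]
      rw [hM, Matrix.of_apply, ← integral_const_mul]
      refine integral_congr_ae (ae_of_all _ fun H => ?_)
      have e : V * H * (V * U (Vᵀ * (V * H)))ᵀ = V * (H * (U H)ᵀ * Vᵀ) := by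
        rw [← Matrix.mul_assoc Vᵀ, hVV', Matrix.one_mul, Matrix.transpose_mul, Matrix.mul_assoc,
          Matrix.mul_assoc]
      change (V * H * (V * U (Vᵀ * (V * H)))ᵀ) i j = _
      rw [e, hV, signedPerm_mul, mul_signedPerm_transpose, ← mul_assoc]
      rfl
    simp only [hentry] at h
    exact h
  have hfin := hS.sum_mem (t := Finset.univ) (w := fun _ => ((n : ℝ) * 2 ^ n)⁻¹)
    (fun _ _ => by positivity) (by simp; field_simp) (fun p _ => hmem p)
  rw [sum_signedPerm_conj, ← htr] at hfin
  simpa [S] using hfin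

/-- The Householder reflection mapping `h` to a nonnegative multiple of the first basis vector. -/
noncomputable def householder {n : ℕ} (h : Fin (n + 1) → ℝ) :
    Matrix (Fin (n + 1)) (Fin (n + 1)) ℝ :=
  let w := h - √(h ⬝ᵥ h) • Pi.single 0 1
  1 - (2 / (w ⬝ᵥ w)) • Matrix.vecMulVec w w

lemma householder_apply {n : ℕ} (h : Fin (n + 1) → ℝ) (i j : Fin (n + 1)) :
    householder h i j = (1 : Matrix (Fin (n + 1)) (Fin (n + 1)) ℝ) i j
      - 2 / ((h - √(h ⬝ᵥ h) • Pi.single 0 1) ⬝ᵥ (h - √(h ⬝ᵥ h) • Pi.single 0 1))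
        * ((h i - √(h ⬝ᵥ h) * (Pi.single 0 1 : Fin (n + 1) → ℝ) i)
          * (h j - √(h ⬝ᵥ h) * (Pi.single 0 1 : Fin (n + 1) → ℝ) j)) := by
  simp [householder, Matrix.vecMulVec_apply]

lemma measurable_householder (n : ℕ) : Measurable (householder (n := n)) := by
  refine measurable_matrix fun i j => ?_
  simp only [householder_apply, dotProduct, Pi.sub_apply, Pi.smul_apply, smul_eq_mul]
  fun_prop

lemma householder_mul_transpose {n : ℕ} (h : Fin (n + 1) → ℝ) :
    householder h * (householder h)ᵀ = 1 := by
  unfold householder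
  generalize h - √(h ⬝ᵥ h) • Pi.single 0 1 = w
  simp only [Matrix.transpose_sub, Matrix.transpose_one, Matrix.transpose_smul,
    Matrix.transpose_vecMulVec, Matrix.mul_sub, Matrix.sub_mul, Matrix.mul_one, Matrix.one_mul,
    Matrix.smul_mul, Matrix.mul_smul, Matrix.vecMulVec_mul_vecMulVec]
  by_cases hw : w ⬝ᵥ w = 0
  · simp [hw]
  · simp only [Matrix.vecMulVec_smul, smul_smul]
    rw [div_mul_cancel₀ _ hw]
    module

lemma householder_mulVec {n : ℕ} (h : Fin (n + 1) → ℝ) :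
    householder h *ᵥ h = √(h ⬝ᵥ h) • Pi.single 0 1 := by
  unfold householder
  set e : Fin (n + 1) → ℝ := Pi.single 0 1 with he
  set r := √(h ⬝ᵥ h) with hr
  have hr2 : r * r = h ⬝ᵥ h := Real.mul_self_sqrt (by simpa using dotProduct_star_self_nonneg h)
  have hee : e ⬝ᵥ e = 1 := by simp [he]
  set w := h - r • e with hw
  have hwh : w ⬝ᵥ w = 2 * (w ⬝ᵥ h) := by
    simp only [hw, sub_dotProduct, dotProduct_sub, smul_dotProduct, dotProduct_smul, smul_eq_mul,
      hee, ← hr2, dotProduct_comm e h]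
    ring
  simp only [Matrix.sub_mulVec, Matrix.one_mulVec, Matrix.smul_mulVec, Matrix.vecMulVec_mulVec]
  by_cases h0 : w ⬝ᵥ w = 0
  · have hw0 : w = 0 := dotProduct_self_eq_zero.1 h0
    rw [h0, div_zero, zero_smul, sub_zero]
    exact sub_eq_zero.1 hw0
  · have : (2 / (w ⬝ᵥ w)) * (w ⬝ᵥ h) = 1 := by
      rw [hwh] at h0 ⊢
      have := right_ne_zero_of_mul h0
      field_simp
    rw [op_smul_eq_smul, smul_smul, this, one_smul, hw, sub_sub_cancel]

lemma householder_zero_dotProduct {n : ℕ} (h : Fin (n + 1) → ℝ) :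
    h ⬝ᵥ householder h 0 = √(h ⬝ᵥ h) := by
  have := congrFun (householder_mulVec h) 0
  rw [dotProduct_comm]
  simpa [Matrix.mulVec] using this

/-- The last `n` rows of `householder h`, transposed: an isometry onto the complement of `h`. -/
noncomputable def householderTail {n : ℕ} (h : Fin (n + 1) → ℝ) :
    Matrix (Fin (n + 1)) (Fin n) ℝ :=
  Matrix.of fun i j => householder h j.succ i

lemma measurable_householderTail (n : ℕ) : Measurable (householderTail (n := n)) :=
  measurable_matrix fun i j => (measurable_householder n).matrix_entry j.succ i

lemma householderTail_transpose_mul_self {n : ℕ} (h : Fin (n + 1) → ℝ) :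
    (householderTail h)ᵀ * householderTail h = 1 := by
  ext i j
  have := congrFun (congrFun (householder_mul_transpose h) i.succ) j.succ
  simp only [Matrix.mul_apply, Matrix.transpose_apply, Matrix.one_apply, Fin.succ_inj] at this
  simpa [Matrix.mul_apply, householderTail, Matrix.one_apply] using this

/-- Append the rows of `B`, transported by `householderTail h`, to the first row of
`householder h`. -/
noncomputable def householderExtend {n : ℕ} (h : Fin (n + 1) → ℝ) (B : Matrix (Fin n) (Fin n) ℝ) :
    Matrix (Fin (n + 1)) (Fin (n + 1)) ℝ :=
  Matrix.of (Fin.cons (householder h 0) (B * (householderTail h)ᵀ))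

lemma householderExtend_mul_transpose {n : ℕ} (h : Fin (n + 1) → ℝ)
    {B : Matrix (Fin n) (Fin n) ℝ} (hB : B * Bᵀ = 1) :
    householderExtend h B * (householderExtend h B)ᵀ = 1 := by
  have h00 : householder h 0 ⬝ᵥ householder h 0 = 1 := by
    simpa [Matrix.mul_apply, dotProduct] using
      congrFun (congrFun (householder_mul_transpose h) 0) 0
  have h0t : (householderTail h)ᵀ *ᵥ householder h 0 = 0 := by
    ext j
    have := congrFun (congrFun (householder_mul_transpose h) j.succ) 0
    simpa [Matrix.mul_apply, Matrix.mulVec, householderTail, dotProduct] using this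
  have hrow : ∀ i, (B * (householderTail h)ᵀ) i ⬝ᵥ householder h 0 = 0 := fun i => by
    change ((B * (householderTail h)ᵀ) *ᵥ householder h 0) i = 0
    rw [← Matrix.mulVec_mulVec, h0t, Matrix.mulVec_zero, Pi.zero_apply]
  have hBB : (B * (householderTail h)ᵀ) * (B * (householderTail h)ᵀ)ᵀ = 1 := by
    rw [Matrix.transpose_mul, Matrix.transpose_transpose, Matrix.mul_assoc,
      ← Matrix.mul_assoc _ (householderTail h), householderTail_transpose_mul_self, Matrix.one_mul,
      hB]
  ext i j
  change householderExtend h B i ⬝ᵥ householderExtend h B j = _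
  cases i using Fin.cases with
  | zero =>
    cases j using Fin.cases with
    | zero => exact h00.trans (Matrix.one_apply_eq _).symm
    | succ j =>
      rw [dotProduct_comm]
      exact (hrow j).trans (Matrix.one_apply_ne (Fin.succ_ne_zero j).symm).symm
  | succ i =>
    cases j using Fin.cases with
    | zero => exact (hrow i).trans (Matrix.one_apply_ne (Fin.succ_ne_zero i)).symm
    | succ j =>
      have := congrFun (congrFun hBB i) j
      rw [Matrix.one_apply] at this ⊢
      simp only [Fin.succ_inj]
      exact this

lemma trace_mul_householderExtend_transpose {n : ℕ} (H : Matrix (Fin (n + 1)) (Fin (n + 1)) ℝ)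
    (K : Matrix (Fin n) (Fin (n + 1)) ℝ) (hK : ∀ i, K i = H i.succ) (B : Matrix (Fin n) (Fin n) ℝ) :
    (H * (householderExtend (H 0) B)ᵀ).trace
      = √(H 0 ⬝ᵥ H 0) + (K * householderTail (H 0) * Bᵀ).trace := by
  have : (K * householderTail (H 0) * Bᵀ) = K * (B * (householderTail (H 0))ᵀ)ᵀ := by
    rw [Matrix.transpose_mul, Matrix.transpose_transpose, Matrix.mul_assoc]
  rw [this, Matrix.trace, Matrix.trace, Fin.sum_univ_succ, ← householder_zero_dotProduct]
  congr 1
  refine Finset.sum_congr rfl fun i _ => ?_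
  change H i.succ ⬝ᵥ (B * (householderTail (H 0))ᵀ) i = K i ⬝ᵥ (B * (householderTail (H 0))ᵀ) i
  rw [hK]

lemma integrable_gaussianVec_sqrt (n : ℕ) (v : NNReal) :
    Integrable (fun h : Fin n → ℝ => √(h ⬝ᵥ h)) (gaussianVec n v) := by
  have h1 : Integrable (fun x : ℝ => x) (gaussianReal 0 v) :=
    memLp_one_iff_integrable.1 (memLp_id_gaussianReal' 1 (by simp))
  have h2 : Integrable (fun x : Fin n → ℝ => ∑ j, |x j|) (gaussianVec n v) :=
    integrable_finsetSum _ fun j _ => ((measurePreserving_eval (fun _ : Fin n => gaussianReal 0 v)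
      j).integrable_comp_of_integrable h1).abs
  refine h2.mono' (Measurable.aestronglyMeasurable ?_) (ae_of_all _ fun h => ?_)
  · simp only [dotProduct]; fun_prop
  · rw [Real.norm_of_nonneg (Real.sqrt_nonneg _)]
    refine Real.sqrt_le_iff.2 ⟨Finset.sum_nonneg fun _ _ => abs_nonneg _, ?_⟩
    calc h ⬝ᵥ h = ∑ j, |h j| ^ 2 := by simp [dotProduct, pow_two]
      _ ≤ (∑ j, |h j|) ^ 2 := Finset.sum_sq_le_sq_sum_of_nonneg fun _ _ => abs_nonneg _

lemma exists_orthogonal_integral_trace (v : NNReal) (n : ℕ) :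
    ∃ U : Matrix (Fin n) (Fin n) ℝ → Matrix (Fin n) (Fin n) ℝ, Measurable U ∧
      (∀ H, U H * (U H)ᵀ = 1) ∧ ∫ H, (H * (U H)ᵀ).trace ∂gaussianMat n n v
        = ∑ d ∈ Finset.range n, ∫ h, √(h ⬝ᵥ h) ∂gaussianVec (d + 1) v := by
  induction n with
  | zero => exact ⟨fun _ => 1, measurable_const, fun _ => by simp, by simp [Matrix.trace]⟩
  | succ n ih =>
    obtain ⟨U, hU, hUo, hUi⟩ := ih
    let tail : Matrix (Fin (n + 1)) (Fin (n + 1)) ℝ → Matrix (Fin n) (Fin (n + 1)) ℝ :=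
      fun H => Matrix.of fun i => H i.succ
    have htail : Measurable tail :=
      measurable_matrix fun i j => measurable_id.matrix_entry i.succ j
    have hrow : Measurable fun H : Matrix (Fin (n + 1)) (Fin (n + 1)) ℝ => H 0 :=
      measurable_pi_lambda _ fun j => measurable_id.matrix_entry 0 j
    let U' : Matrix (Fin (n + 1)) (Fin (n + 1)) ℝ → Matrix (Fin (n + 1)) (Fin (n + 1)) ℝ :=
      fun H => householderExtend (H 0) (U (tail H * householderTail (H 0)))
    refine ⟨U', ?_, fun H => householderExtend_mul_transpose _ (hUo _), ?_⟩
    · refine measurable_matrix fun i j => ?_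
      cases i using Fin.cases with
      | zero => exact ((measurable_householder n).comp hrow).matrix_entry 0 j
      | succ i =>
        exact ((hU.comp (htail.matrix_mul ((measurable_householderTail n).comp hrow))).matrix_mul
          ((measurable_householderTail n).comp hrow).matrix_transpose).matrix_entry i j
    · have hsplit : MeasurePreserving
          (fun H : Matrix (Fin (n + 1)) (Fin (n + 1)) ℝ => (H 0, tail H))
          (gaussianMat (n + 1) (n + 1) v)
          ((gaussianVec (n + 1) v).prod (gaussianMat n (n + 1) v)) :=
        measurePreserving_piFinSuccAbove (fun _ : Fin (n + 1) => gaussianVec (n + 1) v) 0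
      have hskew : MeasurePreserving
          (fun p : (Fin (n + 1) → ℝ) × Matrix (Fin n) (Fin (n + 1)) ℝ =>
            (p.1, p.2 * householderTail p.1))
          ((gaussianVec (n + 1) v).prod (gaussianMat n (n + 1) v))
          ((gaussianVec (n + 1) v).prod (gaussianMat n n v)) :=
        (MeasurePreserving.id _).skew_product (g := fun h K => K * householderTail h)
          (measurable_snd.matrix_mul ((measurable_householderTail n).comp measurable_fst))
          (ae_of_all _ fun h => gaussianMat_map_mul v (householderTail_transpose_mul_self h))
      have hmp := hskew.comp hsplit
      have hm : Measurable fun p : (Fin (n + 1) → ℝ) × Matrix (Fin n) (Fin n) ℝ =>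
          √(p.1 ⬝ᵥ p.1) + (p.2 * (U p.2)ᵀ).trace := by
        refine Measurable.add ?_ ?_
        · simp only [dotProduct]; fun_prop
        · simp only [Matrix.trace, Matrix.diag_apply]
          exact Finset.measurable_sum _ fun i _ => (measurable_snd.matrix_mul
            (hU.comp measurable_snd).matrix_transpose).matrix_entry i i
      have htr : Integrable (fun K : Matrix (Fin n) (Fin n) ℝ => (K * (U K)ᵀ).trace)
          (gaussianMat n n v) := by
        simp only [Matrix.trace, Matrix.diag_apply]
        exact integrable_finsetSum _ fun i _ =>
          integrable_gaussianMat_mul_transpose_entry v hU hUo i i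
      rw [Finset.sum_range_succ, ← hUi, add_comm (∫ H, (H * (U H)ᵀ).trace ∂gaussianMat n n v)]
      calc ∫ H, (H * (U' H)ᵀ).trace ∂gaussianMat (n + 1) (n + 1) v
          = ∫ p : (Fin (n + 1) → ℝ) × Matrix (Fin n) (Fin n) ℝ,
            √(p.1 ⬝ᵥ p.1) + (p.2 * (U p.2)ᵀ).trace
              ∂((gaussianVec (n + 1) v).prod (gaussianMat n n v)) := by
            rw [← hmp.map_eq, integral_map hmp.measurable.aemeasurable hm.aestronglyMeasurable]
            refine integral_congr_ae (ae_of_all _ fun H => ?_)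
            exact trace_mul_householderExtend_transpose H (tail H) (fun _ => rfl) _
        _ = _ := by
            rw [integral_add ((integrable_gaussianVec_sqrt (n + 1) v).comp_fst _)
              (htr.comp_snd _), integral_fun_fst (fun h : Fin (n + 1) → ℝ => √(h ⬝ᵥ h)),
              integral_fun_snd (fun K : Matrix (Fin n) (Fin n) ℝ => (K * (U K)ᵀ).trace)]
            simp

lemma gaussianVec_eq_withDensity (n : ℕ) {v : NNReal} (hv : v ≠ 0) :
    gaussianVec n v = volume.withDensity fun h : Fin n → ℝ =>
      ENNReal.ofReal (∏ i, gaussianPDFReal 0 v (h i)) := by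
  refine Measure.pi_eq fun s hs => ?_
  have hnn : ∀ h : Fin n → ℝ, 0 ≤ ∏ i, gaussianPDFReal 0 v (h i) := fun h =>
    Finset.prod_nonneg fun i _ => gaussianPDFReal_nonneg _ _ _
  rw [withDensity_apply _ (MeasurableSet.univ_pi hs), volume_pi, Measure.restrict_pi_pi,
    ← ofReal_integral_eq_lintegral_ofReal
      (Integrable.fintype_prod fun i => (integrable_gaussianPDFReal 0 v).restrict)
      (ae_of_all _ hnn), integral_fintype_prod_eq_prod,
    ENNReal.ofReal_prod_of_nonneg fun i _ =>
      integral_nonneg fun x => gaussianPDFReal_nonneg _ _ _]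
  exact Finset.prod_congr rfl fun i _ => (gaussianReal_apply_eq_integral 0 hv _).symm

lemma prod_gaussianPDFReal {n : ℕ} (v : NNReal) (h : Fin n → ℝ) :
    ∏ i, gaussianPDFReal 0 v (h i)
      = (√(2 * Real.pi * v))⁻¹ ^ n * Real.exp (-(2 * (v : ℝ))⁻¹ * √(h ⬝ᵥ h) ^ (2 : ℝ)) := by
  have h0 : 0 ≤ h ⬝ᵥ h := by simpa using dotProduct_star_self_nonneg h
  simp only [gaussianPDFReal, sub_zero, Finset.prod_mul_distrib, Finset.prod_const,
    Finset.card_univ, Fintype.card_fin, ← Real.exp_sum, Real.rpow_two, Real.sq_sqrt h0]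
  congr 2
  simp only [dotProduct, Finset.mul_sum]
  refine Finset.sum_congr rfl fun i _ => ?_
  ring

lemma exists_integral_gaussianVec_eq (n : ℕ) [NeZero n] {v : NNReal} (hv : v ≠ 0) :
    ∃ K : ℝ, ∀ φ : ℝ → ℝ, ∫ h, φ √(h ⬝ᵥ h) ∂gaussianVec n v
      = K * ∫ y in Set.Ioi (0 : ℝ),
        y ^ (n - 1) * (Real.exp (-(2 * (v : ℝ))⁻¹ * y ^ (2 : ℝ)) * φ y) := by
  refine ⟨(√(2 * Real.pi * v))⁻¹ ^ n *
    (n * (volume : Measure (EuclideanSpace ℝ (Fin n))).real (Metric.ball 0 1)), fun φ => ?_⟩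
  have hm : Measurable fun h : Fin n → ℝ => ∏ i, gaussianPDFReal 0 v (h i) := by fun_prop
  have hnn : ∀ h : Fin n → ℝ, 0 ≤ ∏ i, gaussianPDFReal 0 v (h i) := fun h =>
    Finset.prod_nonneg fun i _ => gaussianPDFReal_nonneg _ _ _
  have hnorm : ∀ x : EuclideanSpace ℝ (Fin n), √(x.ofLp ⬝ᵥ x.ofLp) = ‖x‖ := fun x => by
    simp [EuclideanSpace.norm_eq, dotProduct, pow_two]
  rw [gaussianVec_eq_withDensity n hv, integral_withDensity_eq_integral_toReal_smul
    hm.ennreal_ofReal (ae_of_all _ fun _ => ENNReal.ofReal_lt_top)]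
  simp_rw [ENNReal.toReal_ofReal (hnn _), prod_gaussianPDFReal, smul_eq_mul,
    mul_assoc ((√(2 * Real.pi * v))⁻¹ ^ n)]
  rw [integral_const_mul, ← (PiLp.volume_preserving_ofLp (Fin n)).integral_comp
    (MeasurableEquiv.toLp 2 (Fin n → ℝ)).symm.measurableEmbedding]
  simp only [hnorm]
  rw [integral_fun_norm_addHaar volume
    fun y : ℝ => Real.exp (-(2 * (v : ℝ))⁻¹ * y ^ (2 : ℝ)) * φ y]
  simp [mul_assoc]

lemma integral_gaussianVec_sqrt (n : ℕ) [NeZero n] {v : NNReal} (hv : v ≠ 0) :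
    ∫ h, √(h ⬝ᵥ h) ∂gaussianVec n v
      = √v * (√2 * Real.Gamma (((n : ℝ) + 1) / 2) / Real.Gamma ((n : ℝ) / 2)) := by
  obtain ⟨K, hK⟩ := exists_integral_gaussianVec_eq n hv
  have hn : 1 ≤ n := NeZero.one_le
  have hn' : (0 : ℝ) < n := by positivity
  have hv' : (0 : ℝ) < v := by positivity
  have hb : (0 : ℝ) < (2 * (v : ℝ))⁻¹ := by positivity
  have h1 := hK fun _ => 1
  have h2 := hK fun y => y
  have e1 := integral_rpow_mul_exp_neg_mul_rpow (p := 2) (q := (n : ℝ) - 1) two_pos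
    (by linarith) hb
  have e2 := integral_rpow_mul_exp_neg_mul_rpow (p := 2) (q := n) two_pos (by linarith) hb
  rw [setIntegral_congr_fun (g := fun y : ℝ => y ^ ((n : ℝ) - 1) *
    Real.exp (-(2 * (v : ℝ))⁻¹ * y ^ (2 : ℝ))) measurableSet_Ioi fun y _ => by
      simp only [mul_one]
      rw [← Nat.cast_one (R := ℝ), ← Nat.cast_sub hn, Real.rpow_natCast], e1] at h1
  rw [setIntegral_congr_fun (g := fun y : ℝ => y ^ (n : ℝ) *
    Real.exp (-(2 * (v : ℝ))⁻¹ * y ^ (2 : ℝ))) measurableSet_Ioi fun y _ => by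
      simp only
      rw [Real.rpow_natCast, ← Nat.sub_add_cancel hn, pow_succ, Nat.sub_add_cancel hn]; ring,
    e2] at h2
  have hG : 0 < Real.Gamma ((n : ℝ) / 2) := Real.Gamma_pos_of_pos (by positivity)
  rw [h2]
  have h3 : (2 * (v : ℝ))⁻¹ ^ (-((n : ℝ) + 1) / 2)
      = (2 * (v : ℝ))⁻¹ ^ (-(n : ℝ) / 2) * (√2 * √v) := by
    rw [← Real.sqrt_mul two_pos.le, show -((n : ℝ) + 1) / 2 = -(n : ℝ) / 2 + -(1 / 2) by ring,
      Real.rpow_add hb, Real.inv_rpow (by positivity) (-(1 / 2)), Real.rpow_neg (by positivity),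
      inv_inv, Real.sqrt_eq_rpow]
  simp only [integral_const, probReal_univ, smul_eq_mul, mul_one, sub_add_cancel] at h1
  rw [h3]
  generalize (2 * (v : ℝ))⁻¹ ^ (-(n : ℝ) / 2) = P at h1
  rw [← mul_div_assoc √(v : ℝ), eq_div_iff hG.ne']
  linear_combination (-(√v * √2 * Real.Gamma (((n : ℝ) + 1) / 2))) * h1

lemma sq_Gamma_add_half_le {x : ℝ} (hx : 0 < x) :
    Real.Gamma (x + 1 / 2) ^ 2 ≤ x * Real.Gamma x ^ 2 := by
  have h := Real.Gamma_mul_add_mul_le_rpow_Gamma_mul_rpow_Gamma (s := x) (t := x + 1) hx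
    (by linarith) (a := 1 / 2) (b := 1 / 2) (by norm_num) (by norm_num) (by norm_num)
  have hG := Real.Gamma_pos_of_pos hx
  have hG' := Real.Gamma_pos_of_pos (show 0 < x + 1 / 2 by linarith)
  rw [show 1 / 2 * x + 1 / 2 * (x + 1) = x + 1 / 2 by ring, ← Real.sqrt_eq_rpow,
    ← Real.sqrt_eq_rpow, ← Real.sqrt_mul hG.le, Real.Gamma_add_one hx.ne', Real.le_sqrt' hG'] at h
  linarith

lemma mul_sq_Gamma_le {x : ℝ} (hx : 0 < x) :
    x ^ 2 * Real.Gamma x ^ 2 ≤ (x + 1 / 2) * Real.Gamma (x + 1 / 2) ^ 2 := by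
  have h := sq_Gamma_add_half_le (show 0 < x + 1 / 2 by linarith)
  rwa [add_assoc, add_halves, Real.Gamma_add_one hx.ne', mul_pow] at h

lemma sq_Gamma_ratio_add_nat_le {x : ℝ} (hx : 1 / 4 < x) (m : ℕ) :
    (Real.Gamma (x + m + 1 / 2) / Real.Gamma (x + m)) ^ 2 / (x + m - 1 / 4)
      ≤ (Real.Gamma (x + 1 / 2) / Real.Gamma x) ^ 2 / (x - 1 / 4) := by
  induction m with
  | zero => simp
  | succ m ih =>
    refine le_trans ?_ ih
    have hy : 1 / 4 < x + m := by linarith [(Nat.cast_nonneg m : (0 : ℝ) ≤ m)]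
    push_cast
    rw [← add_assoc]
    generalize x + m = y at hy
    have hy0 : 0 < y := by linarith
    rw [add_right_comm, Real.Gamma_add_one (by linarith), Real.Gamma_add_one hy0.ne',
      mul_div_mul_comm, mul_pow, mul_comm, mul_div_assoc]
    rw [div_eq_mul_one_div ((Real.Gamma (y + 1 / 2) / Real.Gamma y) ^ 2) (y - 1 / 4)]
    refine mul_le_mul_of_nonneg_left ?_ (sq_nonneg _)
    rw [div_pow, div_div, div_le_div_iff₀ (mul_pos (by positivity) (by linarith)) (by linarith)]
    nlinarith

lemma sub_quarter_le_sq_Gamma_ratio {x : ℝ} (hx : 1 / 4 < x) :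
    x - 1 / 4 ≤ (Real.Gamma (x + 1 / 2) / Real.Gamma x) ^ 2 := by
  have hx' : 0 < x - 1 / 4 := by linarith
  have key : ∀ m : ℕ, 1 - 1 / ((m : ℝ) + 1)
      ≤ (Real.Gamma (x + 1 / 2) / Real.Gamma x) ^ 2 / (x - 1 / 4) := fun m => by
    refine le_trans ?_ (sq_Gamma_ratio_add_nat_le hx m)
    have hm : (0 : ℝ) ≤ m := Nat.cast_nonneg m
    have hy : (1 + m) / 4 < x + m := by linarith
    generalize x + m = y at hy
    have hy0 : 0 < y := by linarith
    have hG := Real.Gamma_pos_of_pos hy0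
    rw [div_pow, div_div, le_div_iff₀ (mul_pos (by positivity) (by linarith))]
    have h1 : (1 - 1 / ((m : ℝ) + 1)) ≤ 1 - 1 / (4 * y) := by
      gcongr
      linarith
    have h2 : (1 - 1 / (4 * y)) * (y - 1 / 4) * (y + 1 / 2) ≤ y ^ 2 := by
      rw [one_sub_div (by positivity), div_mul_eq_mul_div, div_mul_eq_mul_div,
        div_le_iff₀ (by positivity)]
      nlinarith
    have h3 := mul_sq_Gamma_le hy0
    have h4 : (1 - 1 / ((m : ℝ) + 1)) * (y - 1 / 4) * (y + 1 / 2) ≤ y ^ 2 :=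
      le_trans (by gcongr; linarith) h2
    have h5 : 0 < y + 1 / 2 := by linarith
    refine le_of_mul_le_mul_left ?_ h5
    calc (y + 1 / 2) * ((1 - 1 / ((m : ℝ) + 1)) * (Real.Gamma y ^ 2 * (y - 1 / 4)))
        = ((1 - 1 / ((m : ℝ) + 1)) * (y - 1 / 4) * (y + 1 / 2)) * Real.Gamma y ^ 2 := by ring
      _ ≤ y ^ 2 * Real.Gamma y ^ 2 := by gcongr
      _ ≤ _ := h3
  have hlim : Filter.Tendsto (fun m : ℕ => 1 - 1 / ((m : ℝ) + 1)) Filter.atTop (nhds (1 - 0)) :=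
    tendsto_const_nhds.sub tendsto_one_div_add_atTop_nhds_zero_nat
  have := le_of_tendsto' hlim key
  rwa [sub_zero, one_le_div hx'] at this

lemma sqrt_mul_sqrt_le_integral_gaussianVec (n : ℕ) {v : NNReal} (hv : v ≠ 0) :
    √v * √((n : ℝ) + 1 / 2) ≤ ∫ h, √(h ⬝ᵥ h) ∂gaussianVec (n + 1) v := by
  rw [integral_gaussianVec_sqrt (n + 1) hv]
  have hn : (0 : ℝ) ≤ n := Nat.cast_nonneg n
  have h := sub_quarter_le_sq_Gamma_ratio (x := ((n : ℝ) + 1) / 2) (by linarith)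
  have hG := Real.Gamma_pos_of_pos (show 0 < ((n : ℝ) + 1) / 2 by linarith)
  have hG' := Real.Gamma_pos_of_pos (show 0 < ((n : ℝ) + 1) / 2 + 1 / 2 by linarith)
  push_cast
  rw [← add_div] at h hG'
  gcongr
  rw [Real.sqrt_le_left (by positivity), mul_div_assoc, mul_pow, Real.sq_sqrt two_pos.le]
  linarith

lemma two_thirds_mul_sub_le_sqrt {x : ℝ} (hx : 0 ≤ x) :
    2 / 3 * ((x + 1) * √(x + 1) - x * √x) ≤ √(x + 1 / 2) := by
  have ha := Real.sq_sqrt (show 0 ≤ x + 1 by linarith)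
  have hb := Real.sq_sqrt hx
  have ha0 := Real.sqrt_nonneg (x + 1)
  have hb0 := Real.sqrt_nonneg x
  set a := √(x + 1)
  set b := √x
  refine Real.le_sqrt_of_sq_le ?_
  have h1 : a ^ 2 - b ^ 2 = 1 := by linarith
  have e1 : (x + 1) * a - x * b = a ^ 3 - b ^ 3 := by
    linear_combination (-a) * ha + b * hb
  have e2 : x + 1 / 2 = (a ^ 2 + b ^ 2) / 2 := by linarith
  rw [e1, e2]
  have h3 : (a ^ 3 - b ^ 3) * (a + b) = a ^ 2 + a * b + b ^ 2 := by
    linear_combination (a ^ 2 + a * b + b ^ 2) * h1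
  have hs : 0 < (a + b) ^ 2 := by nlinarith
  refine le_of_mul_le_mul_right ?_ hs
  calc (2 / 3 * (a ^ 3 - b ^ 3)) ^ 2 * (a + b) ^ 2
      = 4 / 9 * ((a ^ 3 - b ^ 3) * (a + b)) ^ 2 := by ring
    _ = 4 / 9 * (a ^ 2 + a * b + b ^ 2) ^ 2 := by rw [h3]
    _ ≤ (a ^ 2 + b ^ 2) / 2 * (a + b) ^ 2 := by
      have : 0 ≤ (a ^ 2 + b ^ 2 + 4 * (a * b)) * (a - b) ^ 2 := by positivity
      nlinarith

lemma two_thirds_mul_le_sum_sqrt (n : ℕ) :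
    2 / 3 * ((n : ℝ) * √n) ≤ ∑ d ∈ Finset.range n, √((d : ℝ) + 1 / 2) := by
  induction n with
  | zero => simp
  | succ n ih =>
    rw [Finset.sum_range_succ]
    have := two_thirds_mul_sub_le_sqrt (Nat.cast_nonneg n : (0 : ℝ) ≤ n)
    push_cast
    linarith

/-- **Sublinear comparison principle with absolute constant `1.5`.**  Let `k ≤ n`.  If `μ` is
the Haar probability measure on the Stiefel manifold `V_k^n` and `ν` is the law of an `n × k`
matrix with independent `N(0, 1/n)` entries, then for every nonnegative positively homogeneous
convex function `N` and every weakly increasing convex `Φ : ℝ → ℝ`,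
`E Φ(N(Q)) ≤ E Φ(1.5 · N(G))`. -/
theorem sublinear_comparison_principle_const
    (n k : ℕ) (hn : 0 < n) (hk : 0 < k) (hkn : k ≤ n)
    (μ : Measure (Matrix (Fin n) (Fin k) ℝ)) [IsProbabilityMeasure μ]
    (hμ_stiefel : ∀ᵐ Q ∂μ, Qᵀ * Q = 1)
    (hμ_inv : ∀ U : Matrix (Fin n) (Fin n) ℝ, Uᵀ * U = 1 →
      μ.map (fun Q => U * Q) = μ)
    (ν : Measure (Matrix (Fin n) (Fin k) ℝ))
    (hν : ν = Measure.pi fun _ : Fin n => Measure.pi fun _ : Fin k =>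
      gaussianReal 0 ((n : NNReal))⁻¹)
    (N : Matrix (Fin n) (Fin k) ℝ → ℝ)
    (hN_nonneg : ∀ M, 0 ≤ N M)
    (hN_hom : ∀ (c : ℝ) (M : Matrix (Fin n) (Fin k) ℝ), 0 ≤ c → N (c • M) = c * N M)
    (hN_convex : ConvexOn ℝ Set.univ N)
    (Φ : ℝ → ℝ) (hΦ_mono : Monotone Φ) (hΦ_convex : ConvexOn ℝ Set.univ Φ)
    (hint : Integrable (fun G => Φ (1.5 * N G)) ν) :
    ∫ Q, Φ (N Q) ∂μ ≤ ∫ G, Φ (1.5 * N G) ∂ν := by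
  subst hν
  have : NeZero n := ⟨hn.ne'⟩
  have hn' : (0 : ℝ) < n := Nat.cast_pos.2 hn
  have hNc : Continuous N :=
    continuousOn_univ.1 (ConvexOn.continuousOn (E := Fin n → Fin k → ℝ) isOpen_univ hN_convex)
  have hΦc : Continuous Φ := continuousOn_univ.1 (hΦ_convex.continuousOn isOpen_univ)
  have hfc : Continuous fun G => Φ (1.5 * N G) := hΦc.comp (continuous_const.mul hNc)
  have hf : ConvexOn ℝ Set.univ fun G => Φ (1.5 * N G) := by
    refine ⟨convex_univ, fun x _ y _ a b ha hb hab => ?_⟩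
    refine le_trans (hΦ_mono ?_) (hΦ_convex.2 trivial trivial ha hb hab)
    have := hN_convex.2 (Set.mem_univ x) (Set.mem_univ y) ha hb hab
    simp only [smul_eq_mul] at this ⊢
    linarith
  have hv : (n : NNReal)⁻¹ ≠ 0 := inv_ne_zero (Nat.cast_ne_zero.2 hn.ne')
  obtain ⟨U, hU, hUo, htr⟩ := exists_orthogonal_integral_trace (n : NNReal)⁻¹ n
  refine le_trans ?_ (integral_trace_smul_le hμ_stiefel hμ_inv hf hfc hint hU hUo)
  rw [htr]
  set c := (∑ d ∈ Finset.range n, ∫ h, √(h ⬝ᵥ h) ∂gaussianVec (d + 1) (n : NNReal)⁻¹) / n with hc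
  have hc' : 2 / 3 ≤ c := by
    rw [hc, le_div_iff₀ hn']
    calc 2 / 3 * (n : ℝ) = √((n : NNReal)⁻¹ : NNReal) * (2 / 3 * (n * √n)) := by
          have := Real.sqrt_pos.2 hn'
          push_cast
          rw [Real.sqrt_inv]
          field_simp
      _ ≤ √((n : NNReal)⁻¹ : NNReal) * ∑ d ∈ Finset.range n, √((d : ℝ) + 1 / 2) := by
          gcongr
          exact two_thirds_mul_le_sum_sqrt n
      _ ≤ _ := by
          rw [Finset.mul_sum]
          exact Finset.sum_le_sum fun d _ => sqrt_mul_sqrt_le_integral_gaussianVec d hv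
  refine integral_mono (integrable_of_bounded_on_stiefel hμ_stiefel (hΦc.comp hNc))
    (integrable_of_bounded_on_stiefel hμ_stiefel (hfc.comp (continuous_const_smul c)))
    fun Q => hΦ_mono ?_
  rw [hN_hom c Q (by linarith), ← mul_assoc]
  exact le_mul_of_one_le_left (hN_nonneg Q) (by linarith)
end
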